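/- arXiv:2108.10384 — 3 statements merged into one kernel-verified Lean document; each statement's English description precedes it below -/
import Mathlib

section
/- Let G be a finite generalised dicyclic group such that (i) G is not a generalised quaternion group Q_{2^r} (r ≥ 3), (ii) G is not of the form Q_{2^r} × C₂ or Q_{2^r} × C₂ × C₂ × C₂ (r ≥ 3), and (iii) G is not isomorphic to any of the groups Dic₃, Dic₅, Dic₆, G₁₆. Then α(G) ≤ |G|. -/
/-- `graphAlpha G` is the minimum number of vertices of a finite simple graph whose
automorphism group is isomorphic to `G`. -/
noncomputable def graphAlpha (G : Type*) [Group G] : ℕ :=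
  sInf {n : ℕ | ∃ Γ : SimpleGraph (Fin n), Nonempty ((Γ ≃g Γ) ≃* G)}

/-- The cyclic group of order `n`. -/
abbrev Cyc (n : ℕ) := Multiplicative (ZMod n)
/-- Relators of `G₁₆ = ⟨x, b ∣ x⁴ = b⁴ = 1, b x b⁻¹ = x⁻¹⟩`. -/
def G16Rels : Set (FreeGroup (Fin 2)) :=
  {(FreeGroup.of 0) ^ 4, (FreeGroup.of 1) ^ 4,
    FreeGroup.of 1 * FreeGroup.of 0 * (FreeGroup.of 1)⁻¹ * FreeGroup.of 0}

/-- `G₁₆ = ⟨x, b ∣ x⁴ = b⁴ = 1, b x b⁻¹ = x⁻¹⟩ ≅ C₄ ⋊ C₄`. -/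
abbrev G16 := PresentedGroup G16Rels

/-- `G` is generalised dicyclic `Dic(A, b²)`: `A` is an abelian subgroup of
index 2 containing an element of order `2k` for some `k ≥ 2`, and `b ∈ G \ A`
satisfies `b⁴ = 1`, `b² ∈ A \ {1}`, and `b a b⁻¹ = a⁻¹` for all `a ∈ A`. -/
def IsGeneralizedDicyclic (G : Type*) [Group G] : Prop :=
  ∃ (A : Subgroup G) (b : G), A.index = 2 ∧
    (∀ x ∈ A, ∀ y ∈ A, x * y = y * x) ∧
    (∃ a ∈ A, ∃ k : ℕ, 2 ≤ k ∧ orderOf a = 2 * k) ∧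
    b ∉ A ∧ b ^ 4 = 1 ∧ b ^ 2 ∈ A ∧ b ^ 2 ≠ 1 ∧ ∀ a ∈ A, b * a * b⁻¹ = a⁻¹

/-- `G` is generated by a copy of the additive abelian group `B` together with an element outside
it, whose square is `h` and which inverts `B` by conjugation. -/
def IsDicOver (G : Type*) [Group G] (B : Type*) [AddCommGroup B] (h : B) : Prop :=
  ∃ (φ : B → G) (b : G), (∀ x y, φ (x + y) = φ x * φ y) ∧ Function.Injective φ ∧
    (∀ x, φ x ≠ b) ∧ b * b = φ h ∧ (∀ x, b * φ x = φ (-x) * b) ∧ ∀ g, ∃ x, g = φ x ∨ g = φ x * b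

namespace IsDicOver

variable {G G' B B' : Type*} [Group G] [Group G'] [AddCommGroup B] [AddCommGroup B'] {h : B}

theorem exists_equiv (hG : IsDicOver G B h) : ∃ e : B ⊕ B ≃ G,
    (∀ x y, e (.inl x) * e (.inl y) = e (.inl (x + y))) ∧
    (∀ x y, e (.inl x) * e (.inr y) = e (.inr (x + y))) ∧
    (∀ x y, e (.inr x) * e (.inl y) = e (.inr (x - y))) ∧
    (∀ x y, e (.inr x) * e (.inr y) = e (.inl (x - y + h))) := by
  obtain ⟨φ, b, hmul, hinj, hb, hbb, hconj, hsurj⟩ := hG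
  have hsub : ∀ x y, φ (x - y) * φ y = φ x := fun x y => by rw [← hmul]; simp
  have hne : ∀ x y, φ x ≠ φ y * b := fun x y hxy => hb (x - y) <| by
    have h1 := hsub x y
    rw [sub_eq_neg_add, hmul, hxy, ← mul_assoc, ← hmul, neg_add_cancel]
    have h0 : φ 0 = 1 := by simpa using hmul 0 0
    rw [h0, one_mul]
  refine ⟨Equiv.ofBijective (Sum.elim φ fun x => φ x * b) ⟨?_, ?_⟩, ?_, ?_, ?_, ?_⟩
  · rintro (x | x) (y | y) hxy
    · simpa using hinj hxy
    · exact absurd hxy (hne _ _)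
    · exact absurd hxy.symm (hne _ _)
    · simpa using hinj (mul_right_cancel hxy)
  · intro g
    obtain ⟨x, rfl | rfl⟩ := hsurj g
    · exact ⟨.inl x, rfl⟩
    · exact ⟨.inr x, rfl⟩
  · intro x y
    exact (hmul x y).symm
  · intro x y
    change φ x * (φ y * b) = φ (x + y) * b
    rw [hmul, mul_assoc]
  · intro x y
    change φ x * b * φ y = φ (x - y) * b
    rw [mul_assoc, hconj, ← mul_assoc, ← hmul, sub_eq_add_neg]
  · intro x y
    change φ x * b * (φ y * b) = φ (x - y + h)
    rw [mul_assoc, ← mul_assoc b, hconj, hmul, sub_eq_add_neg, hmul, mul_assoc, mul_assoc, hbb]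

theorem nonempty_mulEquiv (hG : IsDicOver G B h) (hG' : IsDicOver G' B h) :
    Nonempty (G ≃* G') := by
  obtain ⟨e, h1, h2, h3, h4⟩ := hG.exists_equiv
  obtain ⟨e', h1', h2', h3', h4'⟩ := hG'.exists_equiv
  refine ⟨{ e.symm.trans e' with map_mul' := fun g g' => ?_ }⟩
  obtain ⟨u, rfl⟩ := e.surjective g
  obtain ⟨v, rfl⟩ := e.surjective g'
  rcases u with x | x <;> rcases v with y | y <;> simp [h1, h2, h3, h4, h1', h2', h3', h4']

theorem card_eq [Finite B] (hG : IsDicOver G B h) : Nat.card G = 2 * Nat.card B := by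
  obtain ⟨e, -⟩ := hG.exists_equiv
  rw [← Nat.card_congr e, Nat.card_sum]; ring

theorem congr (hG : IsDicOver G B h) (e : B ≃+ B') {h' : B'} (he : e h = h') :
    IsDicOver G B' h' := by
  obtain ⟨φ, b, hmul, hinj, hb, hbb, hconj, hsurj⟩ := hG
  refine ⟨fun x => φ (e.symm x), b, fun x y => by simp [hmul], hinj.comp e.symm.injective,
    fun x => hb _, by simp [← he, hbb], fun x => by simp [hconj], fun g => ?_⟩
  obtain ⟨x, hx⟩ := hsurj g
  exact ⟨e x, by simpa using hx⟩

theorem prod_right (hG : IsDicOver G B h) {E : Type*} [Group E]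
    (e : Multiplicative B' ≃* E) (he : ∀ x : E, x * x = 1) :
    IsDicOver (G × E) (B × B') (h, 0) := by
  obtain ⟨φ, b, hmul, hinj, hb, hbb, hconj, hsurj⟩ := hG
  have hneg : ∀ x : B', e (.ofAdd (-x)) = e (.ofAdd x) := fun x => by
    rw [ofAdd_neg, map_inv, inv_eq_iff_mul_eq_one, he]
  refine ⟨fun x => (φ x.1, e (.ofAdd x.2)), (b, 1), fun x y => by simp [hmul], ?_, ?_,
    ?_, ?_, ?_⟩
  · rintro ⟨x, y⟩ ⟨x', y'⟩ hxy
    simp only [Prod.mk.injEq] at hxy ⊢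
    exact ⟨hinj hxy.1, by simpa using hxy.2⟩
  · intro x hx
    exact hb _ (congrArg Prod.fst hx)
  · simp [hbb]
  · rintro ⟨x, y⟩
    simp only [Prod.mk_mul_mk, Prod.fst_neg, Prod.snd_neg, hneg, hconj, one_mul, mul_one]
  · rintro ⟨g, y⟩
    obtain ⟨x, hx⟩ := hsurj g
    refine ⟨(x, (e.symm y).toAdd), ?_⟩
    simpa using hx

end IsDicOver

theorem isDicOver_quaternionGroup (n : ℕ) :
    IsDicOver (QuaternionGroup n) (ZMod (2 * n)) (n : ZMod (2 * n)) := by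
  refine ⟨.a, .xa 0, fun x y => by simp, fun x y hxy => by simpa using hxy, by simp, by simp,
    by simp, ?_⟩
  rintro (x | x)
  · exact ⟨x, .inl rfl⟩
  · exact ⟨-x, .inr (by simp)⟩

theorem IsGeneralizedDicyclic.isDicOver {G : Type*} [Group G] {A : Subgroup G} {b : G}
    {B : Type*} [AddCommGroup B] (hA : A.index = 2) (hb : b ∉ A) (hb2 : b ^ 2 ∈ A)
    (hinv : ∀ a ∈ A, b * a * b⁻¹ = a⁻¹) (e : Multiplicative B ≃* A) {h : B}
    (hh : (e (.ofAdd h) : G) = b ^ 2) : IsDicOver G B h := by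
  refine ⟨fun x => e (.ofAdd x), b, by simp, ?_, ?_, ?_, ?_, ?_⟩
  · intro x y hxy
    simpa using hxy
  · rintro x rfl
    exact hb (SetLike.coe_mem _)
  · exact (sq b).symm.trans hh.symm
  · intro x
    have := hinv (e (.ofAdd x)) (SetLike.coe_mem _)
    simp only [ofAdd_neg, map_inv, Subgroup.coe_inv, ← this]
    group
  · intro g
    by_cases hg : g ∈ A
    · exact ⟨(e.symm ⟨g, hg⟩).toAdd, .inl (by simp)⟩
    · have : g * b⁻¹ ∈ A := by
        have := (Subgroup.mul_mem_iff_of_index_two hA (a := g) (b := b⁻¹)).2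
        apply this
        simp [hg, hb]
      exact ⟨(e.symm ⟨_, this⟩).toAdd, .inr (by simp)⟩

/-- A graph with a partial labelling of its vertices by signs, whose automorphisms preserving the
labelling form a group isomorphic to `B`, and which has an automorphism reversing all signs,
with square `h`, and inverting `B` by conjugation. -/
structure SignedGraph (B : Type) [AddCommGroup B] (h : B) (V : Type) where
  graph : SimpleGraph V
  sign : V → SignType
  rot : B → V → V
  refl : V → V
  rot_add : ∀ a c v, rot (a + c) v = rot a (rot c v)
  rot_faithful : ∀ a, (∀ v, rot a v = v) → a = 0
  rot_adj : ∀ a u v, graph.Adj u v → graph.Adj (rot a u) (rot a v)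
  rot_sign : ∀ a v, sign (rot a v) = sign v
  refl_refl : ∀ v, refl (refl v) = rot h v
  refl_rot : ∀ a v, refl (rot a v) = rot (-a) (refl v)
  refl_adj : ∀ u v, graph.Adj u v → graph.Adj (refl u) (refl v)
  refl_sign : ∀ v, sign (refl v) = -sign v
  complete : ∀ f : graph ≃g graph, (∀ v, sign (f v) = sign v) → ∃ a, ∀ v, f v = rot a v

namespace SignedGraph

variable {B B' : Type} [AddCommGroup B] [AddCommGroup B'] {h : B} {h' : B'} {V V' : Type}

theorem rot_zero (E : SignedGraph B h V) (v : V) : E.rot 0 v = v := by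
  obtain ⟨a, ha⟩ := E.complete (RelIso.refl _) fun _ => rfl
  have : a = 0 := E.rot_faithful a fun v => (ha v).symm
  simpa [this] using (ha v).symm

theorem rot_neg_rot (E : SignedGraph B h V) (a : B) (v : V) : E.rot (-a) (E.rot a v) = v := by
  rw [← E.rot_add, neg_add_cancel, rot_zero]

theorem rot_rot_neg (E : SignedGraph B h V) (a : B) (v : V) : E.rot a (E.rot (-a) v) = v := by
  rw [← E.rot_add, add_neg_cancel, rot_zero]

/-- A map preserving adjacency with a two-sided inverse preserving adjacency is an
automorphism. -/
def isoOfInverse {Γ : SimpleGraph V} (f g : V → V) (hfg : ∀ v, f (g v) = v) (hgf : ∀ v, g (f v) = v)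
    (hf : ∀ u v, Γ.Adj u v → Γ.Adj (f u) (f v)) (hg : ∀ u v, Γ.Adj u v → Γ.Adj (g u) (g v)) :
    Γ ≃g Γ where
  toFun := f
  invFun := g
  left_inv := hgf
  right_inv := hfg
  map_rel_iff' {u v} := ⟨fun huv => by simpa [hgf] using hg _ _ huv, hf u v⟩

/-- No connected component has more than `c` vertices. -/
def ComponentsLE (Γ : SimpleGraph V) (c : ℕ) : Prop :=
  ∀ v, {w | Γ.Reachable v w}.ncard ≤ c

theorem reachable_inl {Γ : SimpleGraph V} {Γ' : SimpleGraph V'} {u : V} {w : V ⊕ V'}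
    (hw : (Γ ⊕g Γ').Reachable (.inl u) w) : ∃ v, w = .inl v ∧ Γ.Reachable u v := by
  rw [SimpleGraph.reachable_iff_reflTransGen] at hw
  induction hw with
  | refl => exact ⟨u, rfl, .refl _⟩
  | tail _ hbc ih =>
    obtain ⟨v, rfl, hv⟩ := ih
    rename_i c _
    cases c with
    | inl c => exact ⟨c, rfl, hv.trans (SimpleGraph.Adj.reachable hbc)⟩
    | inr c => exact absurd hbc (by simp)

theorem reachable_inr {Γ : SimpleGraph V} {Γ' : SimpleGraph V'} {u : V'} {w : V ⊕ V'}
    (hw : (Γ ⊕g Γ').Reachable (.inr u) w) : ∃ v, w = .inr v ∧ Γ'.Reachable u v := by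
  obtain ⟨v, hv, huv⟩ := reachable_inl (w := w.swap)
    (hw.map (SimpleGraph.Iso.sumComm (G := Γ) (H := Γ')).toHom)
  exact ⟨v, by simpa using congrArg Sum.swap hv, huv⟩

theorem ComponentsLE.sum [Finite V] [Finite V'] {Γ : SimpleGraph V} {Γ' : SimpleGraph V'} {c : ℕ}
    (hΓ : ComponentsLE Γ c) (hΓ' : ComponentsLE Γ' c) : ComponentsLE (Γ ⊕g Γ') c := by
  rintro (u | u)
  · refine le_trans (le_trans (Set.ncard_le_ncard (t := Sum.inl '' {w | Γ.Reachable u w}) ?_) ?_)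
      (hΓ u)
    · intro w hw
      obtain ⟨v, rfl, hv⟩ := reachable_inl hw
      exact ⟨v, hv, rfl⟩
    · exact Set.ncard_image_le
  · refine le_trans (le_trans (Set.ncard_le_ncard (t := Sum.inr '' {w | Γ'.Reachable u w}) ?_) ?_)
      (hΓ' u)
    · intro w hw
      obtain ⟨v, rfl, hv⟩ := reachable_inr hw
      exact ⟨v, hv, rfl⟩
    · exact Set.ncard_image_le

theorem componentsLE_card [Finite V] (Γ : SimpleGraph V) : ComponentsLE Γ (Nat.card V) := fun _ =>
  (Set.ncard_le_ncard (Set.subset_univ _)).trans (Set.ncard_univ V).le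

/-- An automorphism of a disjoint sum fixes the second summand if that summand is connected and has
more vertices than every component of the first. -/
theorem sum_inr_mem [Finite V] [Finite V'] {Γ : SimpleGraph V} {Γ' : SimpleGraph V'}
    (hc : ComponentsLE Γ (Nat.card V' - 1)) (hΓ' : Γ'.Preconnected) [Nonempty V']
    (f : (Γ ⊕g Γ') ≃g (Γ ⊕g Γ')) (v : V') : ∃ w, f (.inr v) = .inr w := by
  rcases hf : f (.inr v) with u | w
  · exfalso
    have key : ∀ w : V', ∃ x, f (.inr w) = .inl x ∧ Γ.Reachable u x := fun w =>
      reachable_inl <| hf ▸ ((hΓ' v w).map SimpleGraph.Embedding.sumInr.toHom).map f.toHom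
    choose g hg hgu using key
    have hinj : Function.Injective g := fun a b hab => by
      have := (hg a).trans (hab ▸ (hg b).symm)
      simpa using this
    have h1 : Nat.card V' ≤ {x | Γ.Reachable u x}.ncard := by
      rw [← Set.ncard_univ V', ← Set.ncard_image_of_injective Set.univ hinj]
      refine Set.ncard_le_ncard ?_ (Set.toFinite _)
      rintro _ ⟨w, -, rfl⟩
      exact hgu w
    have := hc u
    have := Nat.card_pos (α := V')
    omega
  · exact ⟨w, rfl⟩

theorem exists_restrict [Finite V] [Finite V'] {Γ : SimpleGraph V} {Γ' : SimpleGraph V'}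
    (f : (Γ ⊕g Γ') ≃g (Γ ⊕g Γ')) (hf : ∀ v, ∃ w, f (.inr v) = .inr w) :
    ∃ (f₁ : Γ ≃g Γ) (f₂ : Γ' ≃g Γ'), ∀ x, f x = Sum.map f₁ f₂ x := by
  choose g hg using hf
  have hginj : Function.Injective g := fun a b hab => by
    have := (hg a).trans (hab ▸ (hg b).symm)
    simpa using this
  have hgsurj : Function.Surjective g := Finite.surjective_of_injective hginj
  have key : ∀ v, ∃ w, f (.inl v) = .inl w := fun v => by
    rcases hv : f (.inl v) with w | w
    · exact ⟨w, rfl⟩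
    · obtain ⟨u, rfl⟩ := hgsurj w
      have := hv.trans (hg u).symm
      simp at this
  choose k hk using key
  have hkinj : Function.Injective k := fun a b hab => by
    have := (hk a).trans (hab ▸ (hk b).symm)
    simpa using this
  refine ⟨⟨Equiv.ofBijective k (Finite.injective_iff_bijective.1 hkinj), fun {a b} => ?_⟩,
    ⟨Equiv.ofBijective g (Finite.injective_iff_bijective.1 hginj), fun {a b} => ?_⟩, ?_⟩
  · have := f.map_adj_iff (v := .inl a) (w := .inl b)
    rw [hk, hk] at this
    simpa using this
  · have := f.map_adj_iff (v := .inr a) (w := .inr b)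
    rw [hg, hg] at this
    simpa using this
  · rintro (x | x)
    · exact hk x
    · exact hg x

/-- The disjoint sum of signed graphs, provided that no automorphism mixes the two summands. -/
def sum [Finite V] [Finite V'] (E : SignedGraph B h V) (E' : SignedGraph B' h' V')
    (hmix : ∀ (f : (E.graph ⊕g E'.graph) ≃g (E.graph ⊕g E'.graph)) v, ∃ w, f (.inr v) = .inr w) :
    SignedGraph (B × B') (h, h') (V ⊕ V') where
  graph := E.graph ⊕g E'.graph
  sign := Sum.elim E.sign E'.sign
  rot a := Sum.map (E.rot a.1) (E'.rot a.2)
  refl := Sum.map E.refl E'.refl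
  rot_add := by rintro a c (v | v) <;> simp [rot_add]
  rot_faithful a ha := Prod.ext (E.rot_faithful _ fun v => by simpa using ha (.inl v))
    (E'.rot_faithful _ fun v => by simpa using ha (.inr v))
  rot_adj := by
    rintro a (u | u) (v | v) huv
    · exact E.rot_adj _ _ _ huv
    · simp at huv
    · simp at huv
    · exact E'.rot_adj _ _ _ huv
  rot_sign := by rintro a (v | v) <;> simp [rot_sign]
  refl_refl := by rintro (v | v) <;> simp [refl_refl]
  refl_rot := by rintro a (v | v) <;> simp [refl_rot]
  refl_adj := by
    rintro (u | u) (v | v) huv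
    · exact E.refl_adj _ _ huv
    · simp at huv
    · simp at huv
    · exact E'.refl_adj _ _ huv
  refl_sign := by rintro (v | v) <;> simp [refl_sign]
  complete f hf := by
    obtain ⟨f₁, f₂, hff⟩ := exists_restrict f (hmix f)
    obtain ⟨a, ha⟩ := E.complete f₁ fun v => by simpa [hff] using hf (.inl v)
    obtain ⟨c, hc⟩ := E'.complete f₂ fun v => by simpa [hff] using hf (.inr v)
    refine ⟨(a, c), ?_⟩
    rintro (v | v) <;> simp [hff, ha, hc]

end SignedGraph

namespace SignedGraph

variable {B : Type} [AddCommGroup B] {h : B} {V : Type}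

/-- The sign `±1` marked by an apex. -/
def apexSign (e : Bool) : SignType := if e then 1 else -1

theorem apexSign_not (e : Bool) : apexSign (!e) = -apexSign e := by cases e <;> decide

theorem apexSign_injective : Function.Injective apexSign := by decide

/-- The graph obtained from a signed graph by adding two adjacent apices, one for each sign, joined
to all vertices of that sign. -/
def coned (E : SignedGraph B h V) : SimpleGraph (V ⊕ Bool) where
  Adj
    | .inl u, .inl v => E.graph.Adj u v
    | .inl u, .inr e => E.sign u = apexSign e
    | .inr e, .inl u => E.sign u = apexSign e
    | .inr e, .inr e' => e ≠ e'
  symm.symm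
    | .inl _, .inl _ => SimpleGraph.Adj.symm
    | .inl _, .inr _ => id
    | .inr _, .inl _ => id
    | .inr _, .inr _ => Ne.symm
  loopless.irrefl
    | .inl _ => E.graph.irrefl
    | .inr _ => fun h => h rfl

/-- Every vertex has at most `d` neighbours. -/
def DegreeLE (Γ : SimpleGraph V) (d : ℕ) : Prop := ∀ v, (Γ.neighborSet v).ncard ≤ d

theorem rot_rot_same (E : SignedGraph B h V) (v : V) : E.rot h (E.rot h v) = v := by
  have h1 : E.refl (E.rot h (E.refl v)) = E.rot h (E.refl (E.refl v)) := by
    rw [← E.refl_refl, E.refl_refl (E.refl (E.refl v))]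
  rw [E.refl_rot, E.refl_refl, rot_neg_rot] at h1
  exact h1.symm

theorem refl_injective (E : SignedGraph B h V) : Function.Injective E.refl := fun u v huv => by
  have := congrArg (fun x => E.rot (-h) (E.refl x)) huv
  simpa [E.refl_refl, E.rot_neg_rot] using this

theorem ncard_sign_apexSign [Finite V] (E : SignedGraph B h V) (e : Bool) :
    {v | E.sign v = 1}.ncard ≤ {v | E.sign v = apexSign e}.ncard := by
  cases e
  · rw [← Set.ncard_image_of_injective _ E.refl_injective]
    refine Set.ncard_le_ncard ?_ (Set.toFinite _)
    rintro _ ⟨v, hv, rfl⟩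
    simp only [Set.mem_ofPred_eq] at hv ⊢
    rw [E.refl_sign, hv]
    rfl
  · exact le_rfl

theorem coned_map_inr [Finite V] (E : SignedGraph B h V) {d : ℕ} (hd : DegreeLE E.graph d)
    (hp : d < {v | E.sign v = 1}.ncard) (f : E.coned ≃g E.coned) (e : Bool) :
    ∃ e', f (.inr e) = .inr e' := by
  rcases hf : f (.inr e) with v | a
  · exfalso
    have h1 : {v | E.sign v = 1}.ncard + 1 ≤ (E.coned.neighborSet (.inr e)).ncard := by
      refine (Nat.add_le_add_right (E.ncard_sign_apexSign e) 1).trans ?_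
      rw [← Set.ncard_image_of_injective (f := (Sum.inl : V → V ⊕ Bool)) _ Sum.inl_injective,
        ← Set.ncard_insert_of_notMem (a := Sum.inr (!e)) (by simp)]
      refine Set.ncard_le_ncard ?_ (Set.toFinite _)
      rintro x (rfl | ⟨v, hv, rfl⟩)
      · change e ≠ !e
        simp
      · exact hv
    have h2 : (E.coned.neighborSet (.inl v)).ncard ≤ d + 1 := by
      refine le_trans ?_ (Nat.add_le_add_right (hd v) 1)
      rw [← Set.ncard_image_of_injective (f := (Sum.inl : V → V ⊕ Bool)) _ Sum.inl_injective]
      refine le_trans ?_ (Set.ncard_insert_le (.inr (decide (E.sign v = 1))) _)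
      refine Set.ncard_le_ncard ?_ (Set.toFinite _)
      rintro (x | x) hx
      · exact Or.inr ⟨x, hx, rfl⟩
      · left
        have hx : E.sign v = apexSign x := hx
        rw [hx]
        cases x <;> rfl
    have h3 := Nat.card_congr (f.mapNeighborSet (.inr e))
    rw [hf] at h3
    have h4 : (E.coned.neighborSet (.inr e)).ncard = (E.coned.neighborSet (.inl v)).ncard := h3
    omega
  · exact ⟨a, rfl⟩

/-- Rotations extend to the cone. -/
def conedRot (E : SignedGraph B h V) (a : B) : E.coned ≃g E.coned :=
  isoOfInverse (Sum.map (E.rot a) id) (Sum.map (E.rot (-a)) id)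
    (by rintro (v | v) <;> simp [rot_rot_neg]) (by rintro (v | v) <;> simp [rot_neg_rot])
    (by
      rintro (u | u) (v | v) huv
      · exact E.rot_adj _ _ _ huv
      · exact (E.rot_sign _ _).trans huv
      · exact (E.rot_sign _ _).trans huv
      · exact huv)
    (by
      rintro (u | u) (v | v) huv
      · exact E.rot_adj _ _ _ huv
      · exact (E.rot_sign _ _).trans huv
      · exact (E.rot_sign _ _).trans huv
      · exact huv)

theorem refl_adj_apex (E : SignedGraph B h V) :
    ∀ u v, E.coned.Adj u v → E.coned.Adj (Sum.map E.refl not u) (Sum.map E.refl not v) := by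
  rintro (u | u) (v | v) huv
  · exact E.refl_adj _ _ huv
  · exact (E.refl_sign _).trans ((congrArg _ huv).trans (apexSign_not v).symm)
  · exact (E.refl_sign _).trans ((congrArg _ huv).trans (apexSign_not u).symm)
  · exact fun h => huv (Bool.not_inj h)

/-- The sign-reversing automorphism extends to the cone. -/
def conedRefl (E : SignedGraph B h V) : E.coned ≃g E.coned :=
  isoOfInverse (Sum.map E.refl not) (fun v => E.conedRot (-h) (Sum.map E.refl not v))
    (by
      rintro (v | v)
      · simp [conedRot, isoOfInverse, refl_rot, refl_refl, rot_rot_same]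
      · simp [conedRot, isoOfInverse])
    (by
      rintro (v | v)
      · simp [conedRot, isoOfInverse, refl_refl, rot_neg_rot]
      · simp [conedRot, isoOfInverse])
    E.refl_adj_apex
    (fun u v huv => (E.conedRot (-h)).map_adj_iff.2 (E.refl_adj_apex _ _ huv))

theorem isDicOver_aut_coned [Finite V] (E : SignedGraph B h V) {d : ℕ} (hd : DegreeLE E.graph d)
    (hp : d < {v | E.sign v = 1}.ncard) : IsDicOver (E.coned ≃g E.coned) B h := by
  have hpres : ∀ f : E.coned ≃g E.coned, f (.inr true) = .inr true → ∃ a, f = E.conedRot a := by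
    intro f hf
    have hf' : ∀ e, f (.inr e) = .inr e := by
      rintro (_ | _)
      · obtain ⟨e', he'⟩ := E.coned_map_inr hd hp f false
        cases e'
        · exact he'
        · simpa using f.injective (he'.trans hf.symm)
      · exact hf
    have hl : ∀ v, ∃ w, f (.inl v) = .inl w := fun v => by
      rcases hv : f (.inl v) with w | e
      · exact ⟨w, rfl⟩
      · simpa using f.injective (hv.trans (hf' e).symm)
    choose g hg using hl
    have hginj : Function.Injective g := fun a b hab => by
      have := (hg a).trans (hab ▸ (hg b).symm)
      simpa using this
    have hgs : ∀ v, E.sign (g v) = E.sign v := fun v => by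
      have key : ∀ e, E.sign (g v) = apexSign e ↔ E.sign v = apexSign e := fun e => by
        have := f.map_adj_iff (v := .inl v) (w := .inr e)
        rwa [hg, hf'] at this
      have h1 := key true
      have h2 := key false
      revert h1 h2
      generalize E.sign (g v) = x
      generalize E.sign v = y
      revert x y
      decide
    obtain ⟨a, ha⟩ := E.complete
      ⟨Equiv.ofBijective g (Finite.injective_iff_bijective.1 hginj), fun {a b} => by
        have := f.map_adj_iff (v := .inl a) (w := .inl b)
        rwa [hg, hg] at this⟩ hgs
    refine ⟨a, RelIso.ext ?_⟩
    rintro (v | v)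
    · exact (hg v).trans (congrArg _ (ha v))
    · exact hf' v
  refine ⟨E.conedRot, E.conedRefl, ?_, ?_, ?_, ?_, ?_, ?_⟩
  · intro x y
    refine RelIso.ext ?_
    rintro (v | v)
    · exact congrArg _ (E.rot_add x y v)
    · rfl
  · intro x y hxy
    rw [← sub_eq_zero]
    refine E.rot_faithful _ fun v => ?_
    have h1 : E.rot x v = E.rot y v := Sum.inl_injective (congrArg (fun f => f (.inl v)) hxy)
    rw [sub_eq_neg_add, E.rot_add, h1, rot_neg_rot]
  · intro x hx
    have := congrArg (fun f => f (.inr true)) hx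
    exact absurd (Sum.inr_injective this) (by decide)
  · refine RelIso.ext ?_
    rintro (v | v)
    · exact congrArg _ (E.refl_refl v)
    · exact congrArg _ (Bool.not_not v)
  · intro x
    refine RelIso.ext ?_
    rintro (v | v)
    · exact congrArg _ (E.refl_rot x v)
    · rfl
  · intro f
    obtain ⟨_ | _, he⟩ := E.coned_map_inr hd hp f true
    · obtain ⟨a, ha⟩ := hpres (f * E.conedRefl⁻¹) (by
        obtain ⟨e', he'⟩ := E.coned_map_inr hd hp f false
        have : f (.inr false) = .inr true := by
          cases e'
          · simpa using f.injective (he'.trans he.symm)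
          · exact he'
        exact this)
      exact ⟨a, .inr (by rw [← ha]; group)⟩
    · obtain ⟨a, ha⟩ := hpres f he
      exact ⟨a, .inl ha⟩

end SignedGraph

theorem graphAlpha_le_of_aut {G : Type*} [Group G] {V : Type} [Finite V] (Γ : SimpleGraph V)
    (e : (Γ ≃g Γ) ≃* G) : graphAlpha G ≤ Nat.card V := by
  have := Fintype.ofFinite V
  have i := Γ.overFinIso (n := Nat.card V) Nat.card_eq_fintype_card.symm
  refine Nat.sInf_le ⟨_, ⟨MulEquiv.trans ⟨⟨fun f => (i.trans f).trans i.symm,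
    fun f => (i.symm.trans f).trans i, fun f => ?_, fun f => ?_⟩, fun f g => ?_⟩ e⟩⟩
  · ext x; simp
  · ext x; simp
  · ext x; simp

theorem SignedGraph.graphAlpha_le {B : Type} [AddCommGroup B] {h : B} {V : Type} [Finite V]
    (E : SignedGraph B h V) {d : ℕ} (hd : DegreeLE E.graph d)
    (hp : d < {v | E.sign v = 1}.ncard) {G : Type*} [Group G] (hG : IsDicOver G B h) :
    graphAlpha G ≤ Nat.card V + 2 := by
  obtain ⟨e⟩ := (E.isDicOver_aut_coned hd hp).nonempty_mulEquiv hG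
  simpa using graphAlpha_le_of_aut _ e

theorem ZMod.natCast_ne_natCast {n a b : ℕ} (ha : a < n) (hb : b < n) (hab : a ≠ b) :
    (a : ZMod n) ≠ b := fun h => hab <| by
  rwa [ZMod.natCast_eq_natCast_iff', Nat.mod_eq_of_lt ha, Nat.mod_eq_of_lt hb] at h

/-- An injective self-map of `ZMod m` sending neighbours in the cycle to neighbours is a rotation or
a reflection. -/
theorem ZMod.eq_add_or_eq_sub {m : ℕ} (hm : 3 ≤ m) {f : ZMod m → ZMod m}
    (hf : Function.Injective f) (hadj : ∀ x, f (x + 1) = f x + 1 ∨ f x = f (x + 1) + 1) :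
    (∀ x, f x = f 0 + x) ∨ ∀ x, f x = f 0 - x := by
  have : NeZero m := ⟨by omega⟩
  have h2 : (2 : ZMod m) ≠ 0 := by
    exact_mod_cast ZMod.natCast_ne_natCast (a := 2) (b := 0) (by omega) (by omega) (by omega)
  have hne : ∀ x, f (x + 1 + 1) ≠ f x := fun x hx => h2 <| by
    linear_combination hf hx
  have hstep : ∀ x, f (x + 1 + 1) - f (x + 1) = f (x + 1) - f x := fun x => by
    rcases hadj x with h1 | h1 <;> rcases hadj (x + 1) with h3 | h3
    · linear_combination h3 - h1
    · exact absurd (by linear_combination h1 - h3) (hne x)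
    · exact absurd (by linear_combination h3 - h1) (hne x)
    · linear_combination h1 - h3
  have hdiff : ∀ k : ℕ, f (k + 1) - f k = f (0 + 1) - f 0 := fun k => by
    induction k with
    | zero => simp
    | succ k ih => push_cast; rw [hstep, ih]
  have hall : ∀ k : ℕ, f k = f 0 + k * (f (0 + 1) - f 0) := fun k => by
    induction k with
    | zero => simp
    | succ k ih =>
      push_cast
      linear_combination hdiff k + ih
  rcases hadj 0 with h0 | h0
  · left
    intro x
    have := hall x.val
    rw [ZMod.natCast_zmod_val] at this
    linear_combination this + x * h0
  · right
    intro x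
    have := hall x.val
    rw [ZMod.natCast_zmod_val] at this
    linear_combination this - x * h0

theorem SimpleGraph.preconnected_of_reachable {V : Type*} {Γ : SimpleGraph V} (v : V)
    (h : ∀ w, Γ.Reachable v w) : Γ.Preconnected := fun a b => (h a).symm.trans (h b)

theorem SimpleGraph.reachable_of_zmod_chain {V : Type*} {Γ : SimpleGraph V} {m : ℕ} [NeZero m]
    (g : ZMod m → V) (h : ∀ x, Γ.Adj (g x) (g (x + 1))) (x : ZMod m) :
    Γ.Reachable (g 0) (g x) := by
  have key : ∀ k : ℕ, Γ.Reachable (g 0) (g k) := fun k => by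
    induction k with
    | zero => simp
    | succ k ih => push_cast; exact ih.trans (h k).reachable
  simpa using key x.val

namespace SignedGraph

/-- `(B, h)` is realised by a signed graph with `s` vertices, components of size at most `c`,
degrees at most `d`, and at least `p` positive vertices. -/
def Realized (B : Type) [AddCommGroup B] (h : B) (s c d p : ℕ) : Prop :=
  ∃ (V : Type) (_ : Finite V) (E : SignedGraph B h V), Nat.card V = s ∧ ComponentsLE E.graph c ∧
    DegreeLE E.graph d ∧ p ≤ {v | E.sign v = 1}.ncard

/-- `(B, h)` is realised by a connected signed graph with `s` vertices, degrees at most `d`, and at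
least `p` positive vertices. -/
def ConnectedlyRealized (B : Type) [AddCommGroup B] (h : B) (s d p : ℕ) : Prop :=
  ∃ (V : Type) (_ : Finite V) (E : SignedGraph B h V), Nat.card V = s ∧ E.graph.Preconnected ∧
    DegreeLE E.graph d ∧ p ≤ {v | E.sign v = 1}.ncard

variable {B B' : Type} [AddCommGroup B] [AddCommGroup B'] {h : B} {h' : B'}

theorem ConnectedlyRealized.realized {s d p : ℕ} (H : ConnectedlyRealized B h s d p) :
    Realized B h s s d p := by
  obtain ⟨V, hV, E, rfl, -, hd, hp⟩ := H
  exact ⟨V, hV, E, rfl, componentsLE_card _, hd, hp⟩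

theorem DegreeLE.sum {V V' : Type} [Finite V] [Finite V'] {Γ : SimpleGraph V} {Γ' : SimpleGraph V'}
    {d : ℕ} (h : DegreeLE Γ d) (h' : DegreeLE Γ' d) : DegreeLE (Γ ⊕g Γ') d := by
  rintro (v | v)
  · refine le_trans (le_trans (Set.ncard_le_ncard (t := Sum.inl '' Γ.neighborSet v) ?_
      (Set.toFinite _)) (Set.ncard_image_le (Set.toFinite _))) (h v)
    rintro (w | w) hw
    · exact ⟨w, hw, rfl⟩
    · simp at hw
  · refine le_trans (le_trans (Set.ncard_le_ncard (t := Sum.inr '' Γ'.neighborSet v) ?_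
      (Set.toFinite _)) (Set.ncard_image_le (Set.toFinite _))) (h' v)
    rintro (w | w) hw
    · simp at hw
    · exact ⟨w, hw, rfl⟩

theorem Realized.prod {s c d p s' d' p' : ℕ} (H : Realized B h s c d p)
    (H' : ConnectedlyRealized B' h' s' d' p') (hc : c < s') :
    Realized (B × B') (h, h') (s + s') s' (max d d') (p + p') := by
  obtain ⟨V, hV, E, rfl, hEc, hd, hp⟩ := H
  obtain ⟨V', hV', E', rfl, hE', hd', hp'⟩ := H'
  have hne : Nonempty V' := (Nat.card_pos_iff.1 (by omega)).1
  refine ⟨V ⊕ V', inferInstance, E.sum E' (sum_inr_mem (fun v => (hEc v).trans (by omega)) hE'),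
    Nat.card_sum, ComponentsLE.sum (fun v => (hEc v).trans hc.le) (componentsLE_card _),
    DegreeLE.sum (fun v => (hd v).trans (le_max_left _ _))
      fun v => (hd' v).trans (le_max_right _ _),
    ?_⟩
  refine (Nat.add_le_add hp hp').trans ?_
  rw [← Set.ncard_image_of_injective (f := (Sum.inl : V → V ⊕ V')) _ Sum.inl_injective,
    ← Set.ncard_image_of_injective (f := (Sum.inr : V' → V ⊕ V')) _ Sum.inr_injective,
    ← Set.ncard_union_eq (by
      rw [Set.disjoint_left]
      rintro _ ⟨_, _, rfl⟩ ⟨_, _, h⟩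
      simp at h)]
  refine Set.ncard_le_ncard ?_ (Set.toFinite _)
  rintro _ (⟨v, hv, rfl⟩ | ⟨v, hv, rfl⟩) <;> exact hv

/-- The cycle on `ZMod m`. -/
def zmodCycle (m : ℕ) (hm : 3 ≤ m) : SimpleGraph (ZMod m) where
  Adj x y := y = x + 1 ∨ x = y + 1
  symm.symm _ _ := Or.symm
  loopless.irrefl x := by
    have : ((1 : ℕ) : ZMod m) ≠ (0 : ℕ) :=
      ZMod.natCast_ne_natCast (by omega) (by omega) (by omega)
    simp only [Nat.cast_one, Nat.cast_zero] at this
    rintro (h | h) <;> exact this (by linear_combination -h)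

section Cycle

variable (l n : ℕ)

theorem zmultiplesHom_natCast_eq_zero : zmultiplesHom _ (l : ZMod (l * n)) (n : ℤ) = 0 := by
  have := ZMod.natCast_self (l * n)
  push_cast at this
  simp [mul_comm, this]

/-- Multiplication by `l`, as an embedding of `ZMod n` in `ZMod (l * n)`. -/
def mulHom : ZMod n →+ ZMod (l * n) :=
  ZMod.lift n ⟨zmultiplesHom _ (l : ZMod (l * n)), zmultiplesHom_natCast_eq_zero l n⟩

theorem mulHom_natCast (k : ℕ) : mulHom l n k = (l * k : ℕ) := by
  have := ZMod.lift_coe n (⟨zmultiplesHom _ (l : ZMod (l * n)), zmultiplesHom_natCast_eq_zero l n⟩ :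
    { f : ℤ →+ ZMod (l * n) // f n = 0 }) k
  simpa [mul_comm, mulHom] using this

theorem mulHom_injective (hl : l ≠ 0) [NeZero n] : Function.Injective (mulHom l n) := by
  rw [injective_iff_map_eq_zero]
  intro a ha
  rw [← ZMod.natCast_zmod_val a, mulHom_natCast, ZMod.natCast_eq_zero_iff] at ha
  rw [← ZMod.natCast_zmod_val a, ZMod.natCast_eq_zero_iff]
  exact Nat.dvd_of_mul_dvd_mul_left (by omega) ha

/-- Reduction modulo `l`. -/
def residue : ZMod (l * n) →+* ZMod l := ZMod.castHom (dvd_mul_right l n) (ZMod l)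

theorem residue_mulHom [NeZero n] (a : ZMod n) : residue l n (mulHom l n a) = 0 := by
  rw [← ZMod.natCast_zmod_val a, mulHom_natCast, map_natCast, ZMod.natCast_eq_zero_iff]
  exact dvd_mul_right _ _

theorem exists_mulHom_eq [NeZero l] [NeZero n] {x : ZMod (l * n)} (hx : residue l n x = 0) :
    ∃ a, x = mulHom l n a := by
  rw [← ZMod.natCast_zmod_val x, map_natCast, ZMod.natCast_eq_zero_iff] at hx
  obtain ⟨k, hk⟩ := hx
  exact ⟨k, by rw [mulHom_natCast, ← hk, ZMod.natCast_zmod_val]⟩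

/-- The cycle of length `l * n`, with every residue class `1` modulo `l` positive and every residue
class `2` negative. -/
def cycle (hl : 3 ≤ l) (hn : 2 ≤ n) : SignedGraph (ZMod n) 0 (ZMod (l * n)) where
  graph := zmodCycle (l * n) (by nlinarith)
  sign x := if residue l n x = 1 then 1 else if residue l n x = 2 then -1 else 0
  rot a x := x + mulHom l n a
  refl x := 3 - x
  rot_add a c x := by rw [map_add]; ring
  rot_faithful a ha := by
    have : NeZero n := ⟨by omega⟩
    exact mulHom_injective l n (by omega) (by simpa using ha 0)
  rot_adj a x y := Or.imp (fun h => by rw [h]; ring) (fun h => by rw [h]; ring)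
  rot_sign a x := by
    have : NeZero n := ⟨by omega⟩
    rw [map_add, residue_mulHom, add_zero]
  refl_refl x := by simp
  refl_rot a x := by rw [map_neg]; ring
  refl_adj x y := Or.symm ∘ Or.imp (fun h => by rw [h]; ring) (fun h => by rw [h]; ring)
  refl_sign x := by
    have h12 : (1 : ZMod l) ≠ 2 := by
      exact_mod_cast ZMod.natCast_ne_natCast (a := 1) (b := 2) (by omega) (by omega) (by omega)
    rw [map_sub, map_ofNat]
    have h1 : 3 - residue l n x = 1 ↔ residue l n x = 2 :=
      ⟨fun h => by linear_combination -h, fun h => by linear_combination -h⟩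
    have h2 : 3 - residue l n x = 2 ↔ residue l n x = 1 :=
      ⟨fun h => by linear_combination -h, fun h => by linear_combination -h⟩
    rw [if_congr h1 rfl rfl, if_congr h2 rfl rfl]
    by_cases h : residue l n x = 1
    · simp [h, h12]
    · by_cases h' : residue l n x = 2 <;> simp [h, h', h12.symm]
  complete f hf := by
    have : NeZero n := ⟨by omega⟩
    have : NeZero l := ⟨by omega⟩
    have h12 : (1 : ZMod l) ≠ 2 := by
      exact_mod_cast ZMod.natCast_ne_natCast (a := 1) (b := 2) (by omega) (by omega) (by omega)
    have h20 : (2 : ZMod l) ≠ 0 := by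
      exact_mod_cast ZMod.natCast_ne_natCast (a := 2) (b := 0) (by omega) (by omega) (by omega)
    have hf1 : residue l n (f 1) = 1 := by
      by_contra h
      have := hf 1
      rw [if_neg h, if_pos (map_one (residue l n))] at this
      split_ifs at this
    have hf2 : residue l n (f 2) = 2 := by
      have := hf 2
      have h2 : residue l n 2 = 2 := map_ofNat (residue l n) 2
      rw [h2, if_neg h12.symm, if_pos rfl] at this
      split_ifs at this with h h'
      exact h'
    rcases ZMod.eq_add_or_eq_sub (by nlinarith) f.injective
        fun x => f.map_adj_iff.2 (Or.inl rfl) with h | h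
    · rw [h, map_add, map_one, add_eq_right] at hf1
      obtain ⟨a, ha⟩ := exists_mulHom_eq l n hf1
      exact ⟨a, fun x => by rw [h, ha, add_comm]⟩
    · rw [h, map_sub, map_one] at hf1
      rw [h, map_sub, map_ofNat] at hf2
      exact absurd (by linear_combination hf1 - hf2) h20

theorem connectedlyRealized_cycle (hl : 3 ≤ l) (hn : 2 ≤ n) :
    ConnectedlyRealized (ZMod n) 0 (l * n) 2 n := by
  have : NeZero n := ⟨by omega⟩
  have : NeZero l := ⟨by omega⟩
  refine ⟨_, inferInstance, cycle l n hl hn, Nat.card_zmod _,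
    SimpleGraph.preconnected_of_reachable 0
      (SimpleGraph.reachable_of_zmod_chain id fun x => Or.inl rfl), fun v => ?_, ?_⟩
  · refine (Set.ncard_le_ncard (t := {v + 1, v - 1}) ?_ (Set.toFinite _)).trans
      (Set.ncard_insert_le _ _ |>.trans (by simp))
    rintro w (hw | hw)
    · exact Or.inl hw
    · exact Or.inr (by rw [hw]; simp)
  · have hcard : n = ((fun a => mulHom l n a + 1) '' Set.univ).ncard := by
      rw [Set.ncard_image_of_injective Set.univ
        fun a b hab => mulHom_injective l n (by omega) (by simpa using hab), Set.ncard_univ,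
        Nat.card_zmod]
    refine hcard.le.trans (Set.ncard_le_ncard ?_ (Set.toFinite _))
    rintro _ ⟨a, -, rfl⟩
    change ite _ _ _ = _
    rw [if_pos (by simp [residue_mulHom])]

end Cycle

end SignedGraph

namespace SignedGraph

/-- The cycle of length eight with two antipodal chords. -/
def chordedOctagon : SimpleGraph (ZMod 8) where
  Adj x y := y = x + 1 ∨ x = y + 1 ∨ y = x + 4 ∧ 4 * x = 0
  symm.symm := by decide
  loopless.irrefl := by decide

instance : DecidableRel chordedOctagon.Adj := fun x y =>
  inferInstanceAs (Decidable (y = x + 1 ∨ x = y + 1 ∨ y = x + 4 ∧ 4 * x = 0))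

/-- The signs `+ - - + + - - +` on the chorded octagon. -/
def octagonSign (x : ZMod 8) : SignType :=
  if x = 0 ∨ x = 3 ∨ x = 4 ∨ x = 7 then 1 else -1

set_option synthInstance.maxSize 1000 in
set_option synthInstance.maxHeartbeats 400000 in
theorem octagon_rigid : ∀ a₀ : ZMod 8, octagonSign a₀ = 1 →
    ∀ a₁, chordedOctagon.Adj a₀ a₁ → octagonSign a₁ = -1 →
    ∀ a₂, chordedOctagon.Adj a₁ a₂ → octagonSign a₂ = -1 →
    ∀ a₃, chordedOctagon.Adj a₂ a₃ → octagonSign a₃ = 1 →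
    ∀ a₄, chordedOctagon.Adj a₃ a₄ → octagonSign a₄ = 1 → chordedOctagon.Adj a₀ a₄ →
    ∀ a₅, chordedOctagon.Adj a₄ a₅ → octagonSign a₅ = -1 →
    ∀ a₆, chordedOctagon.Adj a₅ a₆ → octagonSign a₆ = -1 → chordedOctagon.Adj a₂ a₆ →
    ∀ a₇, chordedOctagon.Adj a₆ a₇ → octagonSign a₇ = 1 → chordedOctagon.Adj a₇ a₀ →
    (a₀ = 0 ∨ a₀ = 4) ∧ a₁ = a₀ + 1 ∧ a₂ = a₀ + 2 ∧ a₃ = a₀ + 3 ∧ a₄ = a₀ + 4 ∧ a₅ = a₀ + 5 ∧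
      a₆ = a₀ + 6 ∧ a₇ = a₀ + 7 := by
  decide

/-- The signed graph on the chorded octagon, realising the dicyclic group of order four. -/
def octagon : SignedGraph (ZMod 2) 1 (ZMod 8) where
  graph := chordedOctagon
  sign := octagonSign
  rot a x := if a = 0 then x else x + 4
  refl x := x + 2
  rot_add := by decide
  rot_faithful := by decide
  rot_adj := by decide
  rot_sign := by decide
  refl_refl := by decide
  refl_rot := by decide
  refl_adj := by decide
  refl_sign := by decide
  complete f hf := by
    have hadj : ∀ x y, chordedOctagon.Adj x y → chordedOctagon.Adj (f x) (f y) := fun x y =>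
      f.map_adj_iff.2
    obtain ⟨h0, h1, h2, h3, h4, h5, h6, h7⟩ := octagon_rigid (f 0) (hf 0) (f 1)
      (hadj _ _ (by decide)) (hf 1)
      (f 2) (hadj _ _ (by decide)) (hf 2) (f 3) (hadj _ _ (by decide)) (hf 3)
      (f 4) (hadj _ _ (by decide)) (hf 4) (hadj _ _ (by decide))
      (f 5) (hadj _ _ (by decide)) (hf 5)
      (f 6) (hadj _ _ (by decide)) (hf 6) (hadj _ _ (by decide))
      (f 7) (hadj _ _ (by decide)) (hf 7) (hadj _ _ (by decide))
    have hall : ∀ x, f x = f 0 + x := by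
      intro x
      fin_cases x
      exacts [(add_zero _).symm, h1, h2, h3, h4, h5, h6, h7]
    rcases h0 with h0 | h0
    · exact ⟨0, fun x => by rw [hall, h0, if_pos rfl, zero_add]⟩
    · exact ⟨1, fun x => by rw [hall, h0, if_neg (by decide), add_comm]⟩

theorem connectedlyRealized_octagon : ConnectedlyRealized (ZMod 2) 1 8 3 4 := by
  refine ⟨_, inferInstance, octagon, Nat.card_zmod _,
    SimpleGraph.preconnected_of_reachable 0
      (SimpleGraph.reachable_of_zmod_chain id fun x => Or.inl rfl), fun v => ?_, ?_⟩
  · refine (Set.ncard_le_ncard (t := ({v + 1, v - 1, v + 4} : Finset (ZMod 8))) ?_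
      (Set.toFinite _)).trans ((Set.ncard_coe_finset _).le.trans Finset.card_le_three)
    rintro w (hw | hw | hw)
    · simp [hw]
    · simp [hw]
    · simp [hw.1]
  · refine le_trans ?_ (Set.ncard_le_ncard (s := ({0, 3, 4, 7} : Finset (ZMod 8))) ?_
      (Set.toFinite _))
    · rw [Set.ncard_coe_finset]
      decide
    · have key : ∀ v ∈ ({0, 3, 4, 7} : Finset (ZMod 8)), octagonSign v = 1 := by decide
      exact key

/-- The complete graph on two neutral vertices. -/
def edge : SignedGraph (ZMod 2) 0 (ZMod 2) where
  graph := ⊤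
  sign _ := 0
  rot a x := a + x
  refl x := x
  rot_add a c x := add_assoc a c x
  rot_faithful a ha := by simpa using ha 0
  rot_adj a u v := by simp
  rot_sign _ _ := rfl
  refl_refl x := by simp
  refl_rot := by decide
  refl_adj _ _ := id
  refl_sign _ := rfl
  complete f _ := by
    have key : ∀ a b : ZMod 2, a ≠ b → b = a + 1 := by decide
    refine ⟨f 0, fun x => ?_⟩
    fin_cases x
    · exact (add_zero _).symm
    · exact key (f 0) (f 1) (f.injective.ne (by decide))

theorem realized_edge : Realized (ZMod 2) 0 2 2 1 0 := by
  refine ⟨_, inferInstance, edge, Nat.card_zmod _,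
    fun v => (componentsLE_card _ v).trans (Nat.card_zmod _).le, fun v => ?_, Nat.zero_le _⟩
  refine (Set.ncard_le_ncard (t := {v + 1}) ?_ (Set.toFinite _)).trans (by simp)
  intro w hw
  have key : ∀ v w : ZMod 2, v ≠ w → w = v + 1 := by decide
  exact key v w (by simpa [edge, eq_comm] using hw)

end SignedGraph

namespace SignedGraph

/-- The graph on copies of `ZMod n` indexed by `T`, with adjacency determined by differences. -/
def voltageGraph {n : ℕ} {T : Type} (D : T → T → Finset (ZMod n))
    (hD : ∀ s t, ∀ d ∈ D s t, -d ∈ D t s) (hD₀ : ∀ s, 0 ∉ D s s) :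
    SimpleGraph (ZMod n × T) where
  Adj u v := v.1 - u.1 ∈ D u.2 v.2
  symm.symm u v h := by simpa using hD _ _ _ h
  loopless.irrefl u := by simpa using hD₀ u.2

theorem degreeLE_voltageGraph {n : ℕ} {T : Type} [Fintype T] {D : T → T → Finset (ZMod n)}
    {hD : ∀ s t, ∀ d ∈ D s t, -d ∈ D t s} {hD₀ : ∀ s, 0 ∉ D s s} {d : ℕ}
    (hd : ∀ s, ∑ t, (D s t).card ≤ d) : DegreeLE (voltageGraph D hD hD₀) d := fun u => by
  classical
  refine (Set.ncard_le_ncard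
    (t := ((Finset.univ.sigma (D u.2)).image fun x => (u.1 + x.2, x.1) : Finset (ZMod n × T))) ?_
    (Set.toFinite _)).trans ?_
  · intro v hv
    rw [Finset.mem_coe, Finset.mem_image]
    exact ⟨⟨v.2, v.1 - u.1⟩, Finset.mem_sigma.2 ⟨Finset.mem_univ _, hv⟩, by simp⟩
  · rw [Set.ncard_coe_finset]
    exact Finset.card_image_le.trans ((Finset.card_sigma _ _).le.trans (hd u.2))

/-- A signed graph on copies of `ZMod n`, with adjacency determined by differences, in which the
sign-reversing automorphism acts on differences by negation and shift. -/
def voltage {n : ℕ} {T : Type} [Nonempty T] (h : ZMod n) (D : T → T → Finset (ZMod n))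
    (hD : ∀ s t, ∀ d ∈ D s t, -d ∈ D t s) (hD₀ : ∀ s, 0 ∉ D s s) (sgn : T → SignType) (σ : T → T)
    (r : T → ZMod n) (hσ : ∀ s, σ (σ s) = s) (hr : ∀ s, r (σ s) - r s = h)
    (hsgn : ∀ s, sgn (σ s) = -sgn s)
    (hDσ : ∀ s t, ∀ d ∈ D s t, -d + (r t - r s) ∈ D (σ s) (σ t))
    (hcomplete : ∀ f : voltageGraph D hD hD₀ ≃g voltageGraph D hD hD₀,
      (∀ v, sgn (f v).2 = sgn v.2) → ∃ a, ∀ i t, f (i, t) = (a + i, t)) :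
    SignedGraph (ZMod n) h (ZMod n × T) where
  graph := voltageGraph D hD hD₀
  sign v := sgn v.2
  rot a v := (a + v.1, v.2)
  refl v := (-v.1 + r v.2, σ v.2)
  rot_add a c v := by simp [add_assoc]
  rot_faithful a ha := by
    obtain ⟨t⟩ := ‹Nonempty T›
    simpa using congrArg Prod.fst (ha (0, t))
  rot_adj a u v huv := by simpa [voltageGraph] using huv
  rot_sign _ _ := rfl
  refl_refl v := by
    ext
    · simp only
      linear_combination hr v.2
    · exact hσ _
  refl_rot a v := by
    ext
    · simp only
      ring
    · rfl
  refl_adj u v huv := by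
    have := hDσ _ _ _ huv
    change _ ∈ D _ _
    convert this using 1
    ring
  refl_sign v := hsgn _
  complete f hf := (hcomplete f hf).imp fun a ha v => ha v.1 v.2

theorem voltageGraph_eq_rot {n : ℕ} {T : Type} {D : T → T → Finset (ZMod n)}
    {hD : ∀ s t, ∀ d ∈ D s t, -d ∈ D t s} {hD₀ : ∀ s, 0 ∉ D s s}
    (f : voltageGraph D hD hD₀ ≃g voltageGraph D hD hD₀) (hf : ∀ v, (f v).2 = v.2) :
    ∃ g : T → ZMod n → ZMod n, (∀ i t, f (i, t) = (g t i, t)) ∧ (∀ t, Function.Injective (g t)) ∧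
      ∀ s t, ∀ d ∈ D s t, ∀ i, g t (i + d) - g s i ∈ D s t := by
  have key : ∀ i t, f (i, t) = ((f (i, t)).1, t) := fun i t => Prod.ext rfl (hf (i, t))
  refine ⟨fun t i => (f (i, t)).1, key, fun t i j hij => ?_, fun s t d hd i => ?_⟩
  · have : f (i, t) = f (j, t) := by
      rw [key, key j]
      exact congrArg (·, t) hij
    exact congrArg Prod.fst (f.injective this)
  · have : (voltageGraph D hD hD₀).Adj (i, s) (i + d, t) := by simpa [voltageGraph] using hd
    have := f.map_adj_iff.2 this
    rw [key, key (i + d)] at this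
    exact this

theorem le_ncard_voltage {n : ℕ} {T : Type} [Finite T] [NeZero n] (sgn : T → SignType) (t : T)
    (ht : sgn t = 1) : n ≤ {v : ZMod n × T | sgn v.2 = 1}.ncard := by
  have hcard : n = ((fun i : ZMod n => (i, t)) '' Set.univ).ncard := by
    rw [Set.ncard_image_of_injective Set.univ fun a b hab => congrArg Prod.fst hab, Set.ncard_univ,
      Nat.card_zmod]
  refine hcard.le.trans (Set.ncard_le_ncard ?_ (Set.toFinite _))
  rintro _ ⟨a, -, rfl⟩
  exact ht

/-- Differences for two cycles joined by a cubic bipartite graph. -/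
def doubleCycleDiff (n : ℕ) : Bool → Bool → Finset (ZMod n)
  | true, true => {1, -1}
  | false, false => {1, -1}
  | true, false => {0, 1, 3}
  | false, true => {0, -1, -3}

/-- Membership in the difference set of the bipartite part. -/
def MemTriple {R : Type*} [Ring R] (x : R) : Prop := x = 0 ∨ x = 1 ∨ x = 3

section MemTriple

variable {R : Type*} [CommRing R] {k : R}

theorem not_memTriple_of_small
    (hR : (1 : R) ≠ 0 ∧ (2 : R) ≠ 0 ∧ (3 : R) ≠ 0 ∧ (4 : R) ≠ 0 ∧ (5 : R) ≠ 0) :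
    ¬ MemTriple (-1 : R) ∧ ¬ MemTriple (-2 : R) ∧ ¬ MemTriple (2 : R) ∧ ¬ MemTriple (4 : R) := by
  obtain ⟨h1, h2, h3, h4, h5⟩ := hR
  refine ⟨?_, ?_, ?_, ?_⟩ <;> rintro (h | h | h)
  · exact h1 (by linear_combination -h)
  · exact h2 (by linear_combination -h)
  · exact h4 (by linear_combination -h)
  · exact h2 (by linear_combination -h)
  · exact h3 (by linear_combination -h)
  · exact h5 (by linear_combination -h)
  · exact h2 (by linear_combination h)
  · exact h1 (by linear_combination h)
  · exact h1 (by linear_combination -h)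
  · exact h4 (by linear_combination h)
  · exact h3 (by linear_combination h)
  · exact h1 (by linear_combination h)

theorem eq_zero_of_memTriple_add
    (hR : (1 : R) ≠ 0 ∧ (2 : R) ≠ 0 ∧ (3 : R) ≠ 0 ∧ (4 : R) ≠ 0 ∧ (5 : R) ≠ 0)
    (hk : MemTriple k) (hk' : MemTriple (k + 1)) : k = 0 := by
  obtain ⟨-, -, hp2, hp4⟩ := not_memTriple_of_small hR
  rcases hk with rfl | rfl | rfl
  · rfl
  · exact absurd hk' (by norm_num [hp2])
  · exact absurd hk' (by norm_num [hp4])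

theorem not_memTriple_sub
    (hR : (1 : R) ≠ 0 ∧ (2 : R) ≠ 0 ∧ (3 : R) ≠ 0 ∧ (4 : R) ≠ 0 ∧ (5 : R) ≠ 0)
    (hk : MemTriple k) (hk₂ : MemTriple (k - 2)) (hk₄ : MemTriple (k - 4)) : False := by
  obtain ⟨hn1, hn2, -, -⟩ := not_memTriple_of_small hR
  rcases hk with rfl | rfl | rfl
  · exact absurd hk₂ (by norm_num [hn2])
  · exact absurd hk₂ (by norm_num [hn1])
  · exact absurd hk₄ (by norm_num [hn1])

theorem not_memTriple_sub_of_odd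
    (hR : (1 : R) ≠ 0 ∧ (2 : R) ≠ 0 ∧ (3 : R) ≠ 0 ∧ (4 : R) ≠ 0 ∧ (5 : R) ≠ 0)
    (hk : MemTriple k) (hk₁ : MemTriple (k - 1)) (hk₃ : MemTriple (k - 3)) : False := by
  obtain ⟨hn1, hn2, hp2, -⟩ := not_memTriple_of_small hR
  rcases hk with rfl | rfl | rfl
  · exact absurd hk₁ (by norm_num [hn1])
  · exact absurd hk₃ (by norm_num [hn2])
  · exact absurd hk₁ (by norm_num [hp2])

end MemTriple

theorem connectedlyRealized_doubleCycle {n : ℕ} (hn : 7 ≤ n) :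
    ConnectedlyRealized (ZMod n) 0 (2 * n) 5 n := by
  have : NeZero n := ⟨by omega⟩
  have hne : ∀ k : ℕ, 0 < k → k < 7 → (k : ZMod n) ≠ 0 := fun k hk hk' => by
    simpa using ZMod.natCast_ne_natCast (n := n) (a := k) (b := 0) (by omega) (by omega) (by omega)
  have h1 : (1 : ZMod n) ≠ 0 := by exact_mod_cast hne 1 (by norm_num) (by norm_num)
  have h2 : (2 : ZMod n) ≠ 0 := by exact_mod_cast hne 2 (by norm_num) (by norm_num)
  have h3 : (3 : ZMod n) ≠ 0 := by exact_mod_cast hne 3 (by norm_num) (by norm_num)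
  have h4 : (4 : ZMod n) ≠ 0 := by exact_mod_cast hne 4 (by norm_num) (by norm_num)
  have h5 : (5 : ZMod n) ≠ 0 := by exact_mod_cast hne 5 (by norm_num) (by norm_num)
  have hD : ∀ s t, ∀ d ∈ doubleCycleDiff n s t, -d ∈ doubleCycleDiff n t s := by
    rintro (_ | _) (_ | _) d hd <;>
      simp only [doubleCycleDiff, Finset.mem_insert, Finset.mem_singleton] at hd ⊢ <;>
      rcases hd with rfl | rfl | rfl <;> simp
  have hD₀ : ∀ s, (0 : ZMod n) ∉ doubleCycleDiff n s s := by
    rintro (_ | _) <;> simp [doubleCycleDiff, h1.symm, h1]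
  let E : SignedGraph (ZMod n) 0 (ZMod n × Bool) :=
    voltage 0 (doubleCycleDiff n) hD hD₀ apexSign not 0 Bool.not_not (by simp) apexSign_not
      (by
        rintro (_ | _) (_ | _) d hd <;>
          simp only [doubleCycleDiff, Finset.mem_insert, Finset.mem_singleton] at hd ⊢ <;>
          rcases hd with rfl | rfl | rfl <;> simp)
      (by
        intro f hs
        obtain ⟨g, hg, hinj, hgD⟩ := voltageGraph_eq_rot f fun v => apexSign_injective (hs v)
        have hadj : ∀ t x, g t (x + 1) = g t x + 1 ∨ g t x = g t (x + 1) + 1 := fun t x => by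
          have : g t (x + 1) - g t x ∈ ({1, -1} : Finset (ZMod n)) := by
            have := hgD t t 1 (by cases t <;> simp [doubleCycleDiff]) x
            cases t <;> simpa [doubleCycleDiff] using this
          rw [Finset.mem_insert, Finset.mem_singleton] at this
          exact this.imp (fun h => by linear_combination h) fun h => by linear_combination -h
        have hcross : ∀ d, MemTriple d → ∀ i, MemTriple (g false (i + d) - g true i) :=
          fun d hd i => by
            simpa [doubleCycleDiff, MemTriple] using
              hgD true false d (by simpa [doubleCycleDiff, MemTriple] using hd) i
        have hcross₀ : ∀ i, MemTriple (g false i - g true i) := fun i => by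
          simpa using hcross 0 (.inl rfl) i
        rcases ZMod.eq_add_or_eq_sub (by omega) (hinj true) (hadj true) with ht | ht <;>
          rcases ZMod.eq_add_or_eq_sub (by omega) (hinj false) (hadj false) with hf | hf
        · have hk0 := eq_zero_of_memTriple_add ⟨h1, h2, h3, h4, h5⟩ (hcross₀ 0)
            (by convert hcross 1 (.inr (.inl rfl)) 0 using 1; rw [hf (0 + 1)]; ring)
          refine ⟨g true 0, ?_⟩
          rintro i (_ | _)
          · rw [hg, hf, sub_eq_zero.1 hk0]
          · rw [hg, ht]
        · refine (not_memTriple_sub ⟨h1, h2, h3, h4, h5⟩ (hcross₀ 0) ?_ ?_).elim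
          · convert hcross₀ 1 using 1
            linear_combination ht 1 - hf 1
          · convert hcross₀ 2 using 1
            linear_combination ht 2 - hf 2
        · refine (not_memTriple_sub ⟨h1, h2, h3, h4, h5⟩ (hcross₀ 0) ?_ ?_).elim
          · convert hcross₀ (-1) using 1
            linear_combination ht (-1) - hf (-1)
          · convert hcross₀ (-2) using 1
            linear_combination ht (-2) - hf (-2)
        · refine (not_memTriple_sub_of_odd ⟨h1, h2, h3, h4, h5⟩ (hcross₀ 0) ?_ ?_).elim
          · convert hcross 1 (.inr (.inl rfl)) 0 using 1
            rw [hf (0 + 1)]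
            ring
          · convert hcross 3 (.inr (.inr rfl)) 0 using 1
            rw [hf (0 + 3)]
            ring)
  refine ⟨_, inferInstance, E, by simp [mul_comm], ?_, ?_, le_ncard_voltage apexSign true rfl⟩
  · have hx : ∀ i, E.graph.Reachable (0, true) (i, true) :=
      SimpleGraph.reachable_of_zmod_chain (fun i => (i, true)) fun i => by
        simp [E, voltage, voltageGraph, doubleCycleDiff]
    refine SimpleGraph.preconnected_of_reachable (0, true) ?_
    rintro ⟨i, _ | _⟩
    · exact (hx i).trans (SimpleGraph.Adj.reachable (by
        simp [E, voltage, voltageGraph, doubleCycleDiff]))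
    · exact hx i
  · refine degreeLE_voltageGraph (hD := hD) (hD₀ := hD₀) ?_
    have h2 : ∀ a b : ZMod n, ({a, b} : Finset (ZMod n)).card ≤ 2 := fun _ _ =>
      Finset.card_le_two
    have h3 : ∀ a b c : ZMod n, ({a, b, c} : Finset (ZMod n)).card ≤ 3 := fun _ _ _ =>
      Finset.card_le_three
    rintro (_ | _)
    · rw [Fintype.sum_bool]
      exact Nat.add_le_add (h3 _ _ _) (h2 _ _)
    · rw [Fintype.sum_bool]
      exact Nat.add_le_add (h2 _ _) (h3 _ _ _)

end SignedGraph

namespace SignedGraph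

/-- The four vertex orbits: two signed ones and two neutral ones. -/
inductive Orbit
  | pos | neg | left | right
  deriving DecidableEq

instance : Fintype Orbit := ⟨{.pos, .neg, .left, .right}, by rintro (_ | _ | _ | _) <;> decide⟩

namespace Orbit

/-- The action of the sign-reversing automorphism on orbits. -/
def flip : Orbit → Orbit
  | pos => neg
  | neg => pos
  | left => right
  | right => left

/-- The sign of an orbit. -/
def sign : Orbit → SignType
  | pos => 1
  | neg => -1
  | left => 0
  | right => 0

/-- The shift of the sign-reversing automorphism on orbits. -/
def shift {n : ℕ} (h : ZMod n) : Orbit → ZMod n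
  | pos => 0
  | neg => h
  | left => 0
  | right => h

/-- Differences for the graph realising generalised quaternion groups. -/
def diff {n : ℕ} (h : ZMod n) : Orbit → Orbit → Finset (ZMod n)
  | pos, neg => {0, h}
  | neg, pos => {0, h}
  | pos, left => {0}
  | left, pos => {0}
  | neg, right => {0}
  | right, neg => {0}
  | pos, right => {0, 1}
  | right, pos => {0, -1}
  | neg, left => {h, h - 1}
  | left, neg => {h, h + 1}
  | _, _ => ∅

variable {n : ℕ} {h : ZMod n}

theorem neg_mem_diff (hh : h + h = 0) :
    ∀ s t, ∀ d ∈ diff h s t, -d ∈ diff h t s := by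
  have hh' : -h = h := neg_eq_of_add_eq_zero_left hh
  rintro (_ | _ | _ | _) (_ | _ | _ | _) d hd <;>
    simp only [diff, Finset.mem_insert, Finset.mem_singleton, Finset.notMem_empty] at hd ⊢ <;>
    rcases hd with rfl | rfl <;> simp [sub_eq_add_neg, hh', add_comm]

theorem shift_mem_diff (hh : h + h = 0) :
    ∀ s t, ∀ d ∈ diff h s t, -d + (shift h t - shift h s) ∈ diff h (flip s) (flip t) := by
  have hh' : -h = h := neg_eq_of_add_eq_zero_left hh
  have hhx : ∀ x, h + (h + x) = x := fun x => by rw [← add_assoc, hh, zero_add]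
  rintro (_ | _ | _ | _) (_ | _ | _ | _) d hd <;>
    simp only [diff, shift, flip, Finset.mem_insert, Finset.mem_singleton, Finset.notMem_empty]
      at hd ⊢ <;>
    rcases hd with rfl | rfl <;> simp [sub_eq_add_neg, hh', hh, hhx, add_comm]

theorem exists_add_of_iso (hh : h + h = 0) (h1 : h ≠ 1) (hn : (1 : ZMod n) ≠ 0)
    (hD₀ : ∀ s : Orbit, 0 ∉ diff h s s)
    (f : voltageGraph (diff h) (neg_mem_diff hh) hD₀ ≃g voltageGraph (diff h) (neg_mem_diff hh) hD₀)
    (hf : ∀ v, sign (f v).2 = sign v.2) : ∃ a, ∀ i t, f (i, t) = (a + i, t) := by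
  have hpos : ∀ i, (f (i, pos)).2 = pos := fun i => by
    have key : ∀ s, sign s = 1 → s = pos := by decide
    exact key _ (hf (i, pos))
  have hneg : ∀ i, (f (i, neg)).2 = neg := fun i => by
    have key : ∀ s, sign s = -1 → s = neg := by decide
    exact key _ (hf (i, neg))
  have hneutral : ∀ s, sign s = 0 → s = left ∨ s = right := by decide
  have hdeg : ∀ t s s', (∀ i, (f (i, t)).2 = t) → (∀ d ∈ diff h t s', d = 0) →
      ∀ i i' j, i ≠ i' → j - i ∈ diff h t s → j - i' ∈ diff h t s → (f (j, s)).2 ≠ s' := by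
    intro t s s' ht hd i i' j hii hi hi' hs
    have himg : ∀ i, j - i ∈ diff h t s → f (i, t) = ((f (j, s)).1, t) := fun i hi => by
      have hadj : (voltageGraph (diff h) (neg_mem_diff hh) hD₀).Adj (i, t) (j, s) := hi
      have : (f (j, s)).1 - (f (i, t)).1 ∈ diff h (f (i, t)).2 (f (j, s)).2 := f.map_adj_iff.2 hadj
      rw [ht, hs] at this
      exact Prod.ext (sub_eq_zero.1 (hd _ this)).symm (ht i)
    exact hii (congrArg Prod.fst (f.injective ((himg i hi).trans (himg i' hi').symm)))
  have hright : ∀ j, (f (j, right)).2 = right := fun j =>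
    (hneutral _ (hf (j, right))).resolve_left <|
      hdeg pos right left hpos (by simp [diff]) j (j - 1) j (fun h => hn (by linear_combination h))
        (by simp [diff]) (by simp [diff])
  have hleft : ∀ j, (f (j, left)).2 = left := fun j =>
    (hneutral _ (hf (j, left))).resolve_right <|
      hdeg neg left right hneg (by simp [diff]) (j - h) (j - h + 1) j
        (fun h => hn (by linear_combination -h)) (by simp [diff])
        (by
          have : j - (j - h + 1) = h - 1 := by ring
          simp [diff, this])
  obtain ⟨g, hg, hinj, hgD⟩ := voltageGraph_eq_rot f (by
    rintro ⟨i, _ | _ | _ | _⟩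
    exacts [hpos i, hneg i, hleft i, hright i])
  have hl : ∀ i, g left i = g pos i := fun i => by
    simpa [diff, sub_eq_zero] using hgD pos left 0 (by simp [diff]) i
  have hr : ∀ i, g right i = g neg i := fun i => by
    simpa [diff, sub_eq_zero] using hgD neg right 0 (by simp [diff]) i
  have hn : ∀ i, g neg i = g pos i := fun i => by
    have e := hgD pos neg 0 (by simp [diff]) i
    have e' := hgD pos right 0 (by simp [diff]) i
    rw [hr] at e'
    simp only [diff, Finset.mem_insert, Finset.mem_singleton, add_zero] at e e'
    rcases e with e | e
    · exact sub_eq_zero.1 e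
    · rcases e' with e' | e'
      · exact sub_eq_zero.1 e'
      · exact absurd (e.symm.trans e') h1
  have hstep : ∀ i, g pos (i + 1) = g pos i + 1 := fun i => by
    have e := hgD pos right 1 (by simp [diff]) i
    rw [hr, hn] at e
    simp only [diff, Finset.mem_insert, Finset.mem_singleton] at e
    rcases e with e | e
    · exact absurd (by linear_combination hinj pos (sub_eq_zero.1 e)) ‹(1 : ZMod n) ≠ 0›
    · linear_combination e
  have hall : ∀ k : ℤ, g pos k = g pos 0 + k := fun k => by
    induction k using Int.induction_on with
    | zero => simp
    | succ k ih => push_cast at ih ⊢; rw [hstep, ih, add_assoc]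
    | pred k ih =>
      have := hstep (-k - 1)
      push_cast at ih ⊢
      rw [sub_add_cancel, ih] at this
      linear_combination -this
  have hall' : ∀ i, g pos i = g pos 0 + i := fun i => by
    obtain ⟨k, rfl⟩ := ZMod.intCast_surjective i
    exact hall k
  refine ⟨g pos 0, ?_⟩
  rintro i (_ | _ | _ | _)
  · rw [hg, hall']
  · rw [hg, hn, hall']
  · rw [hg, hl, hall']
  · rw [hg, hr, hn, hall']

end Orbit

theorem connectedlyRealized_quaternion {n : ℕ} {h : ZMod n} (hn : 2 ≤ n) (hh : h + h = 0)
    (h1 : h ≠ 1) : ConnectedlyRealized (ZMod n) h (4 * n) 5 n := by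
  have : NeZero n := ⟨by omega⟩
  have h10 : (1 : ZMod n) ≠ 0 := by
    exact_mod_cast ZMod.natCast_ne_natCast (a := 1) (b := 0) (by omega) (by omega) (by omega)
  have hD₀ : ∀ s : Orbit, (0 : ZMod n) ∉ Orbit.diff h s s := by
    rintro (_ | _ | _ | _) <;> simp [Orbit.diff]
  have : Nonempty Orbit := ⟨.pos⟩
  let E : SignedGraph (ZMod n) h (ZMod n × Orbit) :=
    voltage h (Orbit.diff h) (Orbit.neg_mem_diff hh) hD₀ Orbit.sign Orbit.flip (Orbit.shift h)
      (by decide)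
      (by
        have hh' : -h = h := neg_eq_of_add_eq_zero_left hh
        rintro (_ | _ | _ | _) <;> simp [Orbit.shift, Orbit.flip, hh'])
      (by decide) (Orbit.shift_mem_diff hh) (Orbit.exists_add_of_iso hh h1 h10 hD₀)
  have hadj : ∀ i j s t, j - i ∈ Orbit.diff h s t → E.graph.Reachable (i, s) (j, t) :=
    fun i j s t hij => SimpleGraph.Adj.reachable hij
  refine ⟨_, inferInstance, E, by simp [mul_comm, Nat.card_eq_fintype_card]; exact Or.inl rfl,
    ?_, ?_, le_ncard_voltage Orbit.sign .pos rfl⟩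
  · have hstep : ∀ i, E.graph.Reachable (i, .pos) (i + 1, .pos) := fun i =>
      (hadj i (i + 1) .pos .right (by simp [Orbit.diff])).trans <|
        (hadj (i + 1) (i + 1) .right .neg (by simp [Orbit.diff])).trans
          (hadj (i + 1) (i + 1) .neg .pos (by simp [Orbit.diff]))
    have hx : ∀ k : ℕ, E.graph.Reachable (0, .pos) (k, .pos) := fun k => by
      induction k with
      | zero => simp
      | succ k ih => push_cast; exact ih.trans (hstep k)
    have hx' : ∀ i, E.graph.Reachable (0, .pos) (i, .pos) := fun i => by
      simpa using hx i.val
    refine SimpleGraph.preconnected_of_reachable (0, .pos) ?_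
    rintro ⟨i, _ | _ | _ | _⟩
    · exact hx' i
    · exact (hx' i).trans (hadj _ _ _ _ (by simp [Orbit.diff]))
    · exact (hx' i).trans (hadj _ _ _ _ (by simp [Orbit.diff]))
    · exact (hx' i).trans (hadj _ _ _ _ (by simp [Orbit.diff]))
  · refine degreeLE_voltageGraph (hD := Orbit.neg_mem_diff hh) (hD₀ := hD₀) ?_
    have h2 : ∀ a b : ZMod n, ({a, b} : Finset (ZMod n)).card ≤ 2 := fun _ _ =>
      Finset.card_le_two
    have hsum : ∀ φ : Orbit → ℕ, ∑ s, φ s = φ .pos + (φ .neg + (φ .left + φ .right)) :=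
      fun φ => rfl
    rintro (_ | _ | _ | _) <;> rw [hsum] <;> simp only [Orbit.diff, Finset.card_singleton,
      Finset.card_empty]
    · linarith [h2 0 h, h2 0 1]
    · linarith [h2 0 h, h2 h (h - 1)]
    · linarith [h2 h (h + 1)]
    · linarith [h2 0 (-1)]

end SignedGraph

namespace SignedGraph

variable {B B' : Type} [AddCommGroup B] [AddCommGroup B'] {h : B} {h' : B'}

theorem Realized.congr {s c d p : ℕ} (H : Realized B h s c d p) (e : B ≃+ B') (he : e h = h') :
    Realized B' h' s c d p := by
  obtain ⟨V, hV, E, hs, hc, hd, hp⟩ := H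
  refine ⟨V, hV, ⟨E.graph, E.sign, fun a => E.rot (e.symm a), E.refl, ?_, ?_, ?_, ?_, ?_, ?_,
    E.refl_adj, E.refl_sign, ?_⟩, hs, hc, hd, hp⟩
  · exact fun a c v => by rw [map_add, E.rot_add]
  · exact fun a ha => by simpa using E.rot_faithful _ ha
  · exact fun a => E.rot_adj _
  · exact fun a => E.rot_sign _
  · exact fun v => by rw [← he, e.symm_apply_apply, E.refl_refl]
  · exact fun a v => by rw [map_neg, E.refl_rot]
  · intro f hf
    obtain ⟨a, ha⟩ := E.complete f hf
    exact ⟨e a, fun v => by rw [e.symm_apply_apply, ha]⟩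

/-- `(B, h)` has a realisation with at most `2 |B| - 2` vertices to which further cyclic factors of
`B` can be attached. -/
def Economical (B : Type) [AddCommGroup B] (h : B) : Prop :=
  ∃ s c d p : ℕ, Realized B h s c d p ∧ c ≤ s ∧ d < p ∧ s + 2 ≤ 2 * Nat.card B ∧ 3 ≤ Nat.card B

theorem Economical.congr (H : Economical B h) (e : B ≃+ B') (he : e h = h') :
    Economical B' h' := by
  obtain ⟨s, c, d, p, H, hc, hd, hs, hB⟩ := H
  rw [Nat.card_congr e.toEquiv] at hs hB
  exact ⟨s, c, d, p, H.congr e he, hc, hd, hs, hB⟩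

theorem Economical.prod_zmod (H : Economical B h) {n : ℕ} (hn : 2 ≤ n) :
    Economical (B × ZMod n) (h, 0) := by
  obtain ⟨s, c, d, p, H, hc, hd, hs, hB⟩ := H
  have h1 : n * (c / n) ≤ c := Nat.mul_div_le c n
  have h2 : c < n * (c / n + 1) := Nat.lt_mul_div_succ c (by omega)
  set l := max 3 (c / n + 1) with hl
  have h3 : n * (c / n + 1) ≤ l * n := by rw [mul_comm]; exact Nat.mul_le_mul_right _ (by omega)
  refine ⟨_, _, _, _, H.prod (connectedlyRealized_cycle l n (by omega) hn) (by omega), by omega,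
    by omega, ?_, ?_⟩ <;> rw [Nat.card_prod, Nat.card_zmod]
  · rcases le_total 3 (c / n + 1) with h4 | h4
    · rw [max_eq_right h4] at hl
      rw [hl]; nlinarith
    · rw [max_eq_left h4] at hl
      rw [hl]; nlinarith
  · nlinarith

theorem Economical.graphAlpha_le (H : Economical B h) {G : Type*} [Group G]
    (hG : IsDicOver G B h) : graphAlpha G ≤ Nat.card G := by
  obtain ⟨s, c, d, p, ⟨V, hV, E, rfl, -, hd, hp⟩, -, hdp, hs, hB⟩ := H
  have : Finite B := Nat.finite_of_card_ne_zero (by omega)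
  rw [hG.card_eq]
  exact (E.graphAlpha_le hd (by omega) hG).trans hs

theorem economical_two_prod_of_seven_le {n : ℕ} (hn : 7 ≤ n) :
    Economical (ZMod 2 × ZMod n) (1, 0) := by
  refine ⟨_, _, _, _, connectedlyRealized_octagon.realized.prod
    (connectedlyRealized_doubleCycle hn) (by omega), by omega, by omega, ?_, ?_⟩ <;>
  rw [Nat.card_prod, Nat.card_zmod, Nat.card_zmod] <;> omega

theorem economical_two_prod_prod_of_three_le {n m : ℕ} (hn : 3 ≤ n) (hm : 3 ≤ m) :
    Economical ((ZMod 2 × ZMod n) × ZMod m) ((1, 0), 0) := by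
  have h1 : m * (3 * n / m) ≤ 3 * n := Nat.mul_div_le _ m
  have h2 : 3 * n < m * (3 * n / m + 1) := Nat.lt_mul_div_succ _ (by omega)
  set l := max 3 (3 * n / m + 1) with hl
  have h3 : m * (3 * n / m + 1) ≤ l * m := by rw [mul_comm]; exact Nat.mul_le_mul_right _ (by omega)
  refine ⟨_, _, _, _, (connectedlyRealized_octagon.realized.prod
    (connectedlyRealized_cycle 3 n le_rfl (by omega)) (by omega)).prod
    (connectedlyRealized_cycle l m (by omega) (by omega)) (by omega), by omega, by omega,
    ?_, ?_⟩ <;>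
  rw [Nat.card_prod, Nat.card_prod, Nat.card_zmod, Nat.card_zmod, Nat.card_zmod]
  · rcases le_total 3 (3 * n / m + 1) with h4 | h4
    · rw [max_eq_right h4] at hl
      rw [hl]; nlinarith
    · rw [max_eq_left h4] at hl
      rw [hl]; nlinarith
  · nlinarith

theorem economical_two_prod_prod_two {n : ℕ} (hn : 3 ≤ n) :
    Economical ((ZMod 2 × ZMod n) × ZMod 2) ((1, 0), 0) := by
  have H : Economical ((ZMod 2 × ZMod 2) × ZMod n) ((0, 1), 0) := by
    refine ⟨_, _, _, _, (realized_edge.prod connectedlyRealized_octagon (by omega)).prod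
      (connectedlyRealized_cycle 3 n le_rfl (by omega)) (by omega), by omega, by omega, ?_, ?_⟩ <;>
    rw [Nat.card_prod, Nat.card_prod, Nat.card_zmod, Nat.card_zmod] <;> omega
  exact H.congr (AddEquiv.prodAssoc.trans AddEquiv.prodComm) rfl

theorem economical_prod {N n : ℕ} {h : ZMod N} (hh : h + h = 0) (h1 : h ≠ 1)
    (hne : 3 * n ≠ 4 * N) (hN : 4 ≤ N) (hn : 3 ≤ n) (hNn : 4 ≤ n ∨ 6 ≤ N) :
    Economical (ZMod N × ZMod n) (h, 0) := by
  have hcard : 4 * N + 3 * n + 2 ≤ 2 * (N * n) := by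
    rcases hNn with h4 | h4 <;> nlinarith
  have hQ := connectedlyRealized_quaternion (by omega) hh h1
  have hC := connectedlyRealized_cycle 3 n le_rfl (by omega)
  rcases hne.lt_or_gt with hlt | hlt
  · have H : Economical (ZMod n × ZMod N) (0, h) := by
      refine ⟨_, _, _, _, hC.realized.prod hQ hlt, by omega, by omega, ?_, ?_⟩ <;>
      rw [Nat.card_prod, Nat.card_zmod, Nat.card_zmod, mul_comm n N] <;> nlinarith
    exact H.congr AddEquiv.prodComm rfl
  · refine ⟨_, _, _, _, hQ.realized.prod hC hlt, by omega, by omega, ?_, ?_⟩ <;>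
    rw [Nat.card_prod, Nat.card_zmod, Nat.card_zmod] <;> nlinarith

theorem economical_prod_prod {N l n l' m : ℕ} {h : ZMod N} (hh : h + h = 0) (h1 : h ≠ 1)
    (hN : 4 ≤ N) (hl : 3 ≤ l) (hn : 2 ≤ n) (hl' : 3 ≤ l') (hm : 2 ≤ m) (h₁ : l * n < l' * m)
    (h₂ : l' * m < 4 * N) (h₃ : l * n + l' * m + 4 * N + 2 ≤ 2 * (N * n * m)) :
    Economical ((ZMod N × ZMod n) × ZMod m) ((h, 0), 0) := by
  have H : Economical ((ZMod n × ZMod m) × ZMod N) ((0, 0), h) := by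
    refine ⟨_, _, _, _, ((connectedlyRealized_cycle l n hl hn).realized.prod
      (connectedlyRealized_cycle l' m hl' hm) h₁).prod
      (connectedlyRealized_quaternion (by omega) hh h1) h₂, by omega, by omega, ?_, ?_⟩ <;>
    rw [Nat.card_prod, Nat.card_prod, Nat.card_zmod, Nat.card_zmod, Nat.card_zmod]
    · linarith [mul_comm (n * m) N, mul_assoc N n m]
    · nlinarith [mul_pos (show 0 < n by omega) (show 0 < m by omega)]
  exact H.congr (AddEquiv.prodComm.trans AddEquiv.prodAssoc.symm) rfl

end SignedGraph

/-- Splitting off one factor of a product of groups. -/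
noncomputable def AddEquiv.piSplit {ι : Type*} {M : ι → Type*} [∀ i, AddCommGroup (M i)] (j : ι) :
    (∀ i, M i) ≃+ M j × ∀ i : {i // i ≠ j}, M i :=
  { toFun := fun f => (f j, fun i => f i)
    invFun := by
      classical
      exact fun f i => if hi : i = j then hi ▸ f.1 else f.2 ⟨i, hi⟩
    left_inv := fun f => by
      funext i
      by_cases hi : i = j
      · subst hi; simp
      · simp [hi]
    right_inv := fun f => by
      refine Prod.ext (by simp) (funext fun i => ?_)
      simp [i.2]
    map_add' := fun _ _ => rfl }

theorem IsDicOver.split {G : Type*} [Group G] {B : Type*} [AddCommGroup B] {h : B} {ι : Type*}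
    {n : ι → ℕ} (hG : IsDicOver G (B × ∀ i, ZMod (n i)) (h, 0)) (j : ι) :
    IsDicOver G ((B × ZMod (n j)) × ∀ i : {i // i ≠ j}, ZMod (n i)) ((h, 0), 0) :=
  hG.congr (((AddEquiv.refl B).prodCongr (AddEquiv.piSplit j)).trans AddEquiv.prodAssoc.symm) rfl

theorem IsDicOver.of_isEmpty {G : Type*} [Group G] {B : Type*} [AddCommGroup B] {h : B} {ι : Type*}
    [IsEmpty ι] {n : ι → ℕ} (hG : IsDicOver G (B × ∀ i, ZMod (n i)) (h, 0)) : IsDicOver G B h :=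
  hG.congr AddEquiv.prodUnique rfl

theorem Nat.card_subtype_ne {ι : Type*} [Finite ι] (j : ι) :
    Nat.card {i // i ≠ j} + 1 = Nat.card ι := by
  classical
  rw [← Finite.card_option, Nat.card_congr (Equiv.optionSubtypeNe j)]

theorem SignedGraph.Economical.graphAlpha_le_of_pi {B : Type} [AddCommGroup B] {h : B}
    (H : Economical B h) {ι : Type} [Finite ι] {n : ι → ℕ} (hn : ∀ i, 2 ≤ n i) {G : Type*} [Group G]
    (hG : IsDicOver G (B × ∀ i, ZMod (n i)) (h, 0)) : graphAlpha G ≤ Nat.card G := by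
  induction hk : Nat.card ι generalizing ι B with
  | zero =>
    have : IsEmpty ι := (Nat.card_eq_zero.mp hk).resolve_right (not_infinite_iff_finite.mpr ‹_›)
    exact H.graphAlpha_le hG.of_isEmpty
  | succ k ih =>
    have : Nonempty ι := Finite.card_pos_iff.mp (by omega)
    obtain ⟨j⟩ := this
    have hj := Nat.card_subtype_ne j
    exact ih (H.prod_zmod (hn j)) (n := fun i : {i // i ≠ j} => n i) (fun i => hn i) (hG.split j)
      (by omega)

theorem IsDicOver.nonempty_mulEquiv_G16 {G : Type*} [Group G]
    (hG : IsDicOver G (ZMod 2 × ZMod 4) (1, 0)) : Nonempty (G ≃* G16) := by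
  refine hG.nonempty_mulEquiv (G' := G16) ?_
  obtain ⟨φ, b, hmul, hinj, hb, hbb, hconj, -⟩ := hG
  have h0 : φ 0 = 1 := by simpa using hmul 0 0
  have hpow : ∀ (m : ℕ) y, φ y ^ m = φ (m • y) := fun m y => by
    induction m with
    | zero => simp [h0]
    | succ m ih => rw [pow_succ, ih, ← hmul, succ_nsmul]
  let f : G16 →* G := PresentedGroup.toGroup (f := ![φ (0, 1), b]) <| by
    rintro r (rfl | rfl | rfl)
    · simp only [map_pow, FreeGroup.lift_apply_of, Matrix.cons_val_zero, hpow]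
      exact h0
    · simp only [map_pow, FreeGroup.lift_apply_of, Matrix.cons_val_one, Matrix.cons_val_zero]
      rw [show b ^ 4 = (b * b) ^ 2 by rw [← pow_two, ← pow_mul], hbb, hpow]
      exact h0
    · simp only [map_mul, map_inv, FreeGroup.lift_apply_of, Matrix.cons_val_one,
        Matrix.cons_val_zero]
      rw [hconj, mul_inv_cancel_right, ← hmul, neg_add_cancel, h0]
  set x : G16 := PresentedGroup.of 0 with hx
  set c : G16 := PresentedGroup.of 1 with hc
  have hfx : f x = φ (0, 1) := PresentedGroup.toGroup.of _
  have hfc : f c = b := PresentedGroup.toGroup.of _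
  have hx4 : x ^ 4 = 1 := PresentedGroup.one_of_mem (rels := G16Rels) (Or.inl rfl)
  have hc4 : c ^ 4 = 1 := PresentedGroup.one_of_mem (rels := G16Rels) (Or.inr (Or.inl rfl))
  have hcx : c * x * c⁻¹ * x = 1 :=
    PresentedGroup.one_of_mem (rels := G16Rels) (Or.inr (Or.inr rfl))
  have hcx' : c * x * c⁻¹ = x⁻¹ := eq_inv_of_mul_eq_one_left hcx
  have hcc : Commute (c * c) x := by
    have h1 : c * c * x * (c * c)⁻¹ = x := by
      rw [show c * c * x * (c * c)⁻¹ = c * (c * x * c⁻¹) * c⁻¹ by group, hcx',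
        show c * x⁻¹ * c⁻¹ = (c * x * c⁻¹)⁻¹ by group, hcx', inv_inv]
    exact mul_inv_eq_iff_eq_mul.mp h1
  have hcc2 : (c * c) ^ 2 = 1 := by rw [← hc4, ← pow_two, ← pow_mul]
  let ψ : ZMod 2 × ZMod 4 → G16 := fun y => (c * c) ^ y.1.val * x ^ y.2.val
  have hψ : ∀ y z, ψ (y + z) = ψ y * ψ z := fun y z => by
    simp only [ψ, Prod.fst_add, Prod.snd_add, ZMod.val_add]
    rw [← pow_eq_pow_mod _ hcc2, ← pow_eq_pow_mod _ hx4, pow_add, pow_add, mul_assoc, mul_assoc,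
      ← mul_assoc (x ^ _), ((hcc.pow_pow _ _).eq).symm, mul_assoc]
  have hψ0 : ψ 0 = 1 := by simp [ψ]
  have hψneg : ∀ y, ψ (-y) = (ψ y)⁻¹ := fun y => eq_inv_of_mul_eq_one_left <| by
    rw [← hψ, neg_add_cancel, hψ0]
  have hfψ : ∀ y, f (ψ y) = φ y := fun y => by
    simp only [ψ, map_mul, map_pow, hfx, hfc, hbb, hpow, ← hmul]
    congr 1
    ext <;> simp
  have hψc : ∀ y, c * ψ y = ψ (-y) * c := fun y => by
    rw [hψneg, ← mul_inv_eq_iff_eq_mul]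
    have h1 : c * ψ y * c⁻¹ = (c * (c * c) * c⁻¹) ^ y.1.val * (c * x * c⁻¹) ^ y.2.val := by
      rw [conj_pow, conj_pow]; simp only [ψ]; group
    have h2 : c * (c * c) * c⁻¹ = (c * c)⁻¹ := eq_inv_of_mul_eq_one_left <| by
      rw [← hcc2, pow_two]; group
    rw [h1, h2, hcx', inv_pow, inv_pow, ← mul_inv_rev, ← (hcc.pow_pow _ _).eq]
  refine ⟨ψ, c, hψ, fun y z hyz => hinj ?_, fun y hy => hb y ?_, ?_, hψc, fun g => ?_⟩
  · rw [← hfψ, hyz, hfψ]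
  · rw [← hfψ, hy, hfc]
  · simp [ψ, ZMod.val_one]
  · have hg : g ∈ Subgroup.closure (Set.range (PresentedGroup.of (rels := G16Rels))) := by
      rw [PresentedGroup.closure_range_of]; trivial
    have hψ' : ∀ y z, ψ y * c * (ψ z * c) = ψ (y - z + (1, 0)) := fun y z => by
      rw [mul_assoc, ← mul_assoc c, hψc, sub_eq_add_neg, hψ, hψ, show ψ (1, 0) = c * c by
        simp [ψ, ZMod.val_one]]
      group
    induction hg using Subgroup.closure_induction with
    | mem g hg =>
      obtain ⟨i, rfl⟩ := hg
      fin_cases i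
      · exact ⟨(0, 1), Or.inl (by simp [ψ, ZMod.val_one'', hx])⟩
      · exact ⟨0, Or.inr (by simp [hψ0, hc])⟩
    | one => exact ⟨0, Or.inl hψ0.symm⟩
    | mul g g' _ _ hg hg' =>
      obtain ⟨y, rfl | rfl⟩ := hg <;> obtain ⟨z, rfl | rfl⟩ := hg'
      · exact ⟨_, Or.inl (hψ y z).symm⟩
      · exact ⟨_, Or.inr (by rw [hψ y z, mul_assoc (ψ y)])⟩
      · exact ⟨_, Or.inr (by rw [mul_assoc, hψc, ← mul_assoc, ← hψ])⟩
      · exact ⟨_, Or.inl (hψ' y z)⟩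
    | inv g _ hg =>
      obtain ⟨y, rfl | rfl⟩ := hg
      · exact ⟨_, Or.inl (hψneg y).symm⟩
      · refine ⟨y - (1, 0), Or.inr (inv_eq_of_mul_eq_one_right ?_)⟩
        rw [hψ', ← hψ0]
        exact congrArg ψ (by rw [sub_sub_self]; rfl)

theorem IsDicOver.nonempty_mulEquiv_quaternionGroup_mul {G : Type*} [Group G] {m n : ℕ}
    (hmn : (2 * m).Coprime n) (hn : Odd n) (hG : IsDicOver G (ZMod (2 * m) × ZMod n) (m, 0)) :
    Nonempty (G ≃* QuaternionGroup (m * n)) := by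
  let e : ZMod (2 * (m * n)) ≃+* ZMod (2 * m) × ZMod n :=
    (ZMod.ringEquivCongr (mul_assoc 2 m n).symm).trans (ZMod.chineseRemainder hmn)
  refine (hG.congr e.symm.toAddEquiv ?_).nonempty_mulEquiv (isDicOver_quaternionGroup (m * n))
  refine e.symm_apply_eq.mpr ?_
  obtain ⟨k, rfl⟩ := hn
  have h2m : (2 : ZMod (2 * m)) * m = 0 := by exact_mod_cast ZMod.natCast_self (2 * m)
  rw [map_natCast]
  ext
  · push_cast
    rw [Prod.fst_mul, Prod.fst_natCast]
    simp
    linear_combination - (k : ZMod (2 * m)) * h2m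
  · simp only [Nat.cast_mul, Prod.snd_mul, Prod.snd_natCast]
    rw [ZMod.natCast_self, mul_zero]

theorem not_isPrimePow_six : ¬ IsPrimePow 6 := by
  rintro ⟨p, k, hp, -, hk⟩
  have hp := hp.nat_prime
  have h2 : 2 ∣ p := Nat.prime_two.dvd_of_dvd_pow (hk ▸ by norm_num : 2 ∣ p ^ k)
  have h3 : 3 ∣ p := Nat.prime_three.dvd_of_dvd_pow (hk ▸ by norm_num : 3 ∣ p ^ k)
  rw [Nat.prime_dvd_prime_iff_eq Nat.prime_two hp] at h2
  rw [Nat.prime_dvd_prime_iff_eq Nat.prime_three hp] at h3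
  omega

open SignedGraph

theorem graphAlpha_le_of_two {G : Type*} [Group G] {ι : Type} [Finite ι] {n : ι → ℕ}
    (hn : ∀ i, IsPrimePow (n i)) (hG : IsDicOver G (ZMod 2 × ∀ i, ZMod (n i)) (1, 0))
    (hn2 : ∃ i, n i ≠ 2) (h3 : IsEmpty (G ≃* QuaternionGroup 3))
    (h5 : IsEmpty (G ≃* QuaternionGroup 5)) (h16 : IsEmpty (G ≃* G16)) :
    graphAlpha G ≤ Nat.card G := by
  have hn' : ∀ i, 2 ≤ n i := fun i => (hn i).two_le
  by_cases h7 : ∃ i, 7 ≤ n i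
  · obtain ⟨i, hi⟩ := h7
    exact (economical_two_prod_of_seven_le hi).graphAlpha_le_of_pi
      (n := fun j : {j // j ≠ i} => n j) (fun j => hn' j) (hG.split i)
  push Not at h7
  obtain ⟨i, hi⟩ := hn2
  have hi6 : n i ≠ 6 := fun h => not_isPrimePow_six (h ▸ hn i)
  have hi3 : 3 ≤ n i := by have := hn' i; omega
  rcases isEmpty_or_nonempty {j // j ≠ i} with hι | ⟨⟨j⟩⟩
  · have hG' := (hG.split i).of_isEmpty (n := fun j : {j // j ≠ i} => n j)
    have hi7 := h7 i
    generalize n i = a at *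
    obtain rfl | rfl | rfl : a = 3 ∨ a = 4 ∨ a = 5 := by omega
    · obtain ⟨e⟩ := IsDicOver.nonempty_mulEquiv_quaternionGroup_mul (m := 1) (n := 3)
        (by norm_num) (by decide) (by simpa using hG')
      exact h3.elim e
    · exact h16.elim hG'.nonempty_mulEquiv_G16.some
    · obtain ⟨e⟩ := IsDicOver.nonempty_mulEquiv_quaternionGroup_mul (m := 1) (n := 5)
        (by norm_num) (by decide) (by simpa using hG')
      exact h5.elim e
  · have H : Economical ((ZMod 2 × ZMod (n i)) × ZMod (n j)) ((1, 0), 0) := by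
      have hj := hn' j
      generalize n j = b at *
      obtain rfl | hj := hj.eq_or_lt
      · exact economical_two_prod_prod_two hi3
      · exact economical_two_prod_prod_of_three_le hi3 hj
    exact H.graphAlpha_le_of_pi (n := fun l : {l // l ≠ j} => n l) (fun l => hn' l)
      (IsDicOver.split (n := fun j : {j // j ≠ i} => n j) (hG.split i) j)

theorem graphAlpha_le_of_two_pow {G : Type*} [Group G] {ι : Type} [Finite ι] {n : ι → ℕ}
    (hn : ∀ i, IsPrimePow (n i)) {k M : ℕ} (hk : 1 ≤ k) (hM : M = 2 ^ k)
    (hG : IsDicOver G (ZMod (2 * M) × ∀ i, ZMod (n i)) (M, 0))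
    (hQ : IsEmpty (G ≃* QuaternionGroup M))
    (hQ2 : IsEmpty (G ≃* QuaternionGroup M × Cyc 2)) (h6 : IsEmpty (G ≃* QuaternionGroup 6)) :
    graphAlpha G ≤ Nat.card G := by
  have hn' : ∀ i, 2 ≤ n i := fun i => (hn i).two_le
  have hM2 : 2 ≤ M := hM ▸ Nat.le_self_pow (by omega) 2
  have hh : (M : ZMod (2 * M)) + M = 0 := by
    rw [← Nat.cast_add, ← two_mul, ZMod.natCast_self]
  have h1 : (M : ZMod (2 * M)) ≠ 1 := by
    simpa using ZMod.natCast_ne_natCast (a := M) (b := 1) (n := 2 * M) (by omega) (by omega)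
      (by omega)
  have hdvd : ¬ 3 ∣ M := fun h => by
    rw [hM] at h
    exact absurd (Nat.prime_three.dvd_of_dvd_pow h) (by norm_num)
  by_cases hbig : ∃ i, 3 ≤ n i ∧ (4 ≤ n i ∨ 6 ≤ 2 * M)
  · obtain ⟨i, hi, hiM⟩ := hbig
    exact (economical_prod hh h1 (by omega) (by omega) hi hiM).graphAlpha_le_of_pi
      (n := fun j : {j // j ≠ i} => n j) (fun j => hn' j) (hG.split i)
  push Not at hbig
  by_cases hthree : ∃ i, 3 ≤ n i
  · obtain ⟨i, hi⟩ := hthree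
    obtain ⟨hi4, hM6⟩ := hbig i hi
    obtain rfl : M = 2 := by omega
    have hi3 : n i = 3 := by omega
    rcases isEmpty_or_nonempty {j // j ≠ i} with hι | ⟨⟨j, hj⟩⟩
    · have hG' := (hG.split i).of_isEmpty (n := fun j : {j // j ≠ i} => n j)
      rw [hi3] at hG'
      obtain ⟨e⟩ := IsDicOver.nonempty_mulEquiv_quaternionGroup_mul (m := 2) (n := 3)
        (by norm_num) (by decide) hG'
      exact h6.elim e
    · obtain hj2 | hj3 : n j = 2 ∨ n j = 3 := by
        have := hn' j
        have := hbig j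
        omega
      · refine (economical_prod_prod (l := 3) (n := n j) (l' := 3) (m := n i) hh h1 (by omega)
          (by omega) (by omega) (by omega) (by omega) (by omega) (by omega)
          (by rw [hi3, hj2]; norm_num)).graphAlpha_le_of_pi
          (n := fun l : {l : {l // l ≠ j} // l ≠ ⟨i, hj.symm⟩} => n l) (fun l => hn' l)
          (IsDicOver.split (n := fun l : {l // l ≠ j} => n l) (hG.split j) ⟨i, hj.symm⟩)
      · refine (economical_prod_prod (l := 3) (n := n i) (l' := 4) (m := n j) hh h1 (by omega)
          (by omega) (by omega) (by omega) (by omega) (by omega) (by omega)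
          (by rw [hi3, hj3]; norm_num)).graphAlpha_le_of_pi
          (n := fun l : {l : {l // l ≠ i} // l ≠ ⟨j, hj⟩} => n l) (fun l => hn' l)
          (IsDicOver.split (n := fun l : {l // l ≠ i} => n l) (hG.split i) ⟨j, hj⟩)
  push Not at hthree
  have h2 : ∀ i, n i = 2 := fun i => by have := hn' i; have := hthree i; omega
  rcases isEmpty_or_nonempty ι with hι | ⟨⟨i⟩⟩
  · exact hQ.elim (hG.of_isEmpty.nonempty_mulEquiv (isDicOver_quaternionGroup M)).some
  rcases isEmpty_or_nonempty {j // j ≠ i} with hι | ⟨⟨j⟩⟩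
  · have hG' := (hG.split i).of_isEmpty (n := fun j : {j // j ≠ i} => n j)
    rw [h2] at hG'
    exact hQ2.elim (hG'.nonempty_mulEquiv ((isDicOver_quaternionGroup M).prod_right
      (MulEquiv.refl (Cyc 2)) (by decide))).some
  · refine (economical_prod_prod (l := 3) (n := n i) (l' := 4) (m := n j) hh h1 (by omega)
      (by omega) (by simp [h2]) (by omega) (by simp [h2]) (by simp [h2]) (by rw [h2]; omega)
      (by rw [h2, h2]; omega)).graphAlpha_le_of_pi
      (n := fun l : {l // l ≠ j} => n l) (fun l => hn' l)
      (IsDicOver.split (n := fun l : {l // l ≠ i} => n l) (hG.split i) j)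

theorem ZMod.pos_and_eq_of_add_self_eq_zero {k : ℕ} {y : ZMod (2 ^ k)} (hy : y ≠ 0)
    (hyy : y + y = 0) : 1 ≤ k ∧ y = ((2 ^ (k - 1) : ℕ) : ZMod (2 ^ k)) := by
  have hlt := ZMod.val_lt y
  have hpos : 0 < y.val := Nat.pos_of_ne_zero (by simpa using hy)
  have hdvd : 2 ^ k ∣ y.val + y.val := by
    rw [← ZMod.natCast_eq_zero_iff]
    simpa using hyy
  have hval : y.val + y.val = 2 ^ k := by
    obtain ⟨c, hc⟩ := hdvd
    have h1 : c < 2 := by by_contra! h; nlinarith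
    interval_cases c <;> omega
  obtain _ | k := k
  · omega
  · refine ⟨by omega, ?_⟩
    have : y.val = 2 ^ k := by have := pow_succ 2 k; omega
    rw [Nat.add_sub_cancel, ← this, ZMod.natCast_zmod_val]

theorem ZMod.exists_addMonoidHom_eq {a b : ℕ} (hab : a ≤ b) {y : ZMod (2 ^ a)} {z : ZMod (2 ^ b)}
    (hy : y ≠ 0) (hyy : y + y = 0) (hzz : z + z = 0) :
    ∃ f : ZMod (2 ^ a) →+ ZMod (2 ^ b), f y = z := by
  by_cases hz : z = 0
  · exact ⟨0, hz.symm⟩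
  obtain ⟨ha, rfl⟩ := ZMod.pos_and_eq_of_add_self_eq_zero hy hyy
  obtain ⟨hb, rfl⟩ := ZMod.pos_and_eq_of_add_self_eq_zero hz hzz
  have h0 : zmultiplesHom (ZMod (2 ^ b)) ((2 ^ (b - a) : ℕ) : ZMod (2 ^ b))
      ((2 ^ a : ℕ) : ℤ) = 0 := by
    rw [zmultiplesHom_apply, natCast_zsmul, nsmul_eq_mul, ← Nat.cast_mul, ← pow_add,
      Nat.add_sub_of_le hab, ZMod.natCast_self]
  refine ⟨ZMod.lift _ ⟨_, h0⟩, ?_⟩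
  have h1 := ZMod.lift_coe (2 ^ a) ⟨_, h0⟩ ((2 ^ (a - 1) : ℕ) : ℤ)
  rw [Int.cast_natCast] at h1
  rw [h1, zmultiplesHom_apply, natCast_zsmul, nsmul_eq_mul, ← Nat.cast_mul, ← pow_add]
  congr 2
  omega

theorem IsPrimePow.exists_eq_two_pow {n : ℕ} (hn : IsPrimePow n) {y : ZMod n} (hy : y ≠ 0)
    (hyy : y + y = 0) : ∃ k, n = 2 ^ k := by
  obtain ⟨p, k, hp, -, rfl⟩ := hn
  have hp := hp.nat_prime
  rcases hp.eq_two_or_odd' with rfl | hodd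
  · exact ⟨k, rfl⟩
  · exact absurd (ZMod.add_self_eq_zero_iff_eq_zero hodd.pow |>.mp hyy) hy

/-- The automorphism `(a, b) ↦ (a, b - f a)` of a product. -/
def AddEquiv.shear {A B : Type*} [AddCommGroup A] [AddCommGroup B] (f : A →+ B) :
    A × B ≃+ A × B where
  toFun x := (x.1, x.2 - f x.1)
  invFun x := (x.1, x.2 + f x.1)
  left_inv x := by simp
  right_inv x := by simp
  map_add' x y := by ext <;> simp; abel

/-- An involution of a product of cyclic groups of prime power order can be moved into one of the
factors. -/
theorem exists_addEquiv_zmod_prod_pi {ι : Type*} [Finite ι] {n : ι → ℕ}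
    (hn : ∀ i, IsPrimePow (n i)) {y : ∀ i, ZMod (n i)} (hy : y ≠ 0) (hyy : y + y = 0) :
    ∃ (j : ι) (e : (∀ i, ZMod (n i)) ≃+ ZMod (n j) × ∀ i : {i // i ≠ j}, ZMod (n i)),
      y j ≠ 0 ∧ e y = (y j, 0) := by
  have hyy' : ∀ i, y i + y i = 0 := fun i => congrFun hyy i
  obtain ⟨j, hj, hmin⟩ := Set.exists_min_image {i | y i ≠ 0} n (Set.toFinite _)
    (Function.ne_iff.mp hy)
  have hj : y j ≠ 0 := hj
  have hex : ∀ i : {i // i ≠ j}, ∃ f : ZMod (n j) →+ ZMod (n i), f (y j) = y i := fun i => by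
    by_cases hi : y i = 0
    · exact ⟨0, hi.symm⟩
    have hle := hmin i hi
    obtain ⟨a, ha⟩ := (hn j).exists_eq_two_pow hj (hyy' j)
    obtain ⟨b, hb⟩ := (hn i).exists_eq_two_pow hi (hyy' i)
    have h1 := hyy' i
    have h2 := hyy' j
    generalize y j = u at *
    generalize y i = v at *
    rw [ha, hb] at hle
    generalize n j = N at *
    generalize n i = N' at *
    subst ha hb
    exact ZMod.exists_addMonoidHom_eq ((Nat.pow_le_pow_iff_right (by omega)).mp hle) hj h2 h1
  choose f hf using hex
  let F : ZMod (n j) →+ ∀ i : {i // i ≠ j}, ZMod (n i) :=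
    { toFun := fun a i => f i a
      map_zero' := by ext; simp
      map_add' := fun a b => by ext; simp }
  refine ⟨j, (AddEquiv.piSplit j).trans (AddEquiv.shear F), hj, ?_⟩
  refine Prod.ext rfl (funext fun i => ?_)
  exact sub_eq_zero.mpr (hf i).symm

/-- Trivial factors of a product may be dropped. -/
noncomputable def AddEquiv.piSubtypeNeOne {ι : Type*} (n : ι → ℕ) :
    (∀ i, ZMod (n i)) ≃+ ∀ i : {i // n i ≠ 1}, ZMod (n i) where
  toFun f i := f i
  invFun f i := by
    classical
    exact if hi : n i ≠ 1 then f ⟨i, hi⟩ else 0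
  left_inv f := by
    funext i
    by_cases hi : n i = 1
    · have : Subsingleton (ZMod (n i)) := by rw [hi]; infer_instance
      exact Subsingleton.elim _ _
    · simp [hi]
  right_inv f := by
    funext i
    simp [i.2]
  map_add' _ _ := rfl

theorem exists_addEquiv_pi_zmod_primePow (A : Type*) [AddCommGroup A] [Finite A] :
    ∃ (ι : Type) (_ : Finite ι) (n : ι → ℕ), (∀ i, IsPrimePow (n i)) ∧
      Nonempty (A ≃+ ∀ i, ZMod (n i)) := by
  obtain ⟨ι, _, p, hp, e, ⟨f⟩⟩ := AddCommGroup.equiv_directSum_zmod_of_finite A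
  refine ⟨{i // p i ^ e i ≠ 1}, inferInstance, fun i => p i ^ e i, fun i => ?_,
    ⟨(f.trans (DirectSum.addEquivProd _)).trans (AddEquiv.piSubtypeNeOne _)⟩⟩
  have he : e i ≠ 0 := fun h => i.2 (by rw [h, pow_zero])
  exact (hp i).isPrimePow.pow he

theorem graphAlpha_le_of_isDicOver {G : Type*} [Group G] {ι : Type} [Finite ι] {n : ι → ℕ}
    (hn : ∀ i, IsPrimePow (n i)) {k N : ℕ} (hN : N = 2 ^ k) {h : ZMod N} (hne : h ≠ 0)
    (hh : h + h = 0) (hG : IsDicOver G (ZMod N × ∀ i, ZMod (n i)) (h, 0))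
    (hexp : ¬ ∀ x : ZMod N × ∀ i, ZMod (n i), x + x = 0)
    (hQ : ∀ m, 1 ≤ m → IsEmpty (G ≃* QuaternionGroup (2 ^ m)))
    (hQ2 : ∀ m, 1 ≤ m → IsEmpty (G ≃* QuaternionGroup (2 ^ m) × Cyc 2))
    (h3 : IsEmpty (G ≃* QuaternionGroup 3)) (h5 : IsEmpty (G ≃* QuaternionGroup 5))
    (h6 : IsEmpty (G ≃* QuaternionGroup 6)) (h16 : IsEmpty (G ≃* G16)) :
    graphAlpha G ≤ Nat.card G := by
  subst hN
  obtain ⟨hk, rfl⟩ := ZMod.pos_and_eq_of_add_self_eq_zero hne hh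
  obtain ⟨m, rfl⟩ : ∃ m, k = m + 1 := ⟨k - 1, by omega⟩
  rw [Nat.add_sub_cancel] at hG
  rcases Nat.eq_zero_or_pos m with rfl | hm
  · refine graphAlpha_le_of_two hn (by simpa using hG) ?_ h3 h5 h16
    by_contra! hall
    refine hexp fun x => Prod.ext (CharTwo.add_self_eq_zero (R := ZMod 2) x.1) (funext fun i => ?_)
    have hx : ∀ z : ZMod (n i), z + z = 0 := by
      rw [hall i]; exact CharTwo.add_self_eq_zero
    exact hx _
  · rw [pow_succ'] at hG
    exact graphAlpha_le_of_two_pow hn hm rfl hG (hQ m hm) (hQ2 m hm) h6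

/-- Proposition: a finite generalised dicyclic group `G` which is not a
generalised quaternion group `Q_{2^r}` (`r ≥ 3`), not of the form
`Q_{2^r} × C₂` or `Q_{2^r} × C₂ × C₂ × C₂` (`r ≥ 3`), and not one of
`Dic₃, Dic₅, Dic₆, G₁₆`, satisfies `α(G) ≤ |G|`. -/
theorem generalizedDicyclic_alpha_le_card (G : Type*) [Group G] [Finite G]
    (hdic : IsGeneralizedDicyclic G)
    (h₁ : ¬ ∃ r : ℕ, 3 ≤ r ∧ Nonempty (G ≃* QuaternionGroup (2 ^ (r - 2))))
    (h₂ : ¬ ∃ r : ℕ, 3 ≤ r ∧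
      (Nonempty (G ≃* (QuaternionGroup (2 ^ (r - 2)) × Cyc 2)) ∨
        Nonempty (G ≃* (QuaternionGroup (2 ^ (r - 2)) ×
          Multiplicative (ZMod 2 × ZMod 2 × ZMod 2)))))
    (h₃ : ¬ (Nonempty (G ≃* QuaternionGroup 3) ∨ Nonempty (G ≃* QuaternionGroup 5) ∨
      Nonempty (G ≃* QuaternionGroup 6) ∨ Nonempty (G ≃* G16))) :
    graphAlpha G ≤ Nat.card G := by
  obtain ⟨A, b, hidx, hcomm, ⟨a, ha, k, hk, hord⟩, hb, hb4, hb2, hb2ne, hinv⟩ := hdic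
  let _ : CommGroup A :=
    { (inferInstance : Group A) with
      mul_comm := fun x y => Subtype.ext (hcomm x x.2 y y.2) }
  obtain ⟨ι, _, n, hn, ⟨e⟩⟩ := exists_addEquiv_pi_zmod_primePow (Additive A)
  set z : Additive A := .ofMul ⟨b ^ 2, hb2⟩ with hz
  have hz0 : z ≠ 0 := fun h => hb2ne (congrArg (fun x : Additive A => (x.toMul : G)) h)
  have hzz : z + z = 0 := by
    refine Additive.toMul.injective (Subtype.ext ?_)
    change b ^ 2 * b ^ 2 = 1
    rw [← hb4, ← pow_add]
  have hG : IsDicOver G (∀ i, ZMod (n i)) (e z) :=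
    IsGeneralizedDicyclic.isDicOver hidx hb hb2 hinv (AddEquiv.toMultiplicativeLeft e.symm)
      (congrArg (fun x : Additive A => (x.toMul : G)) (e.symm_apply_apply z))
  have hyy : e z + e z = 0 := by rw [← map_add, hzz, map_zero]
  obtain ⟨j, e', hj, hy⟩ :=
    exists_addEquiv_zmod_prod_pi hn (e.map_ne_zero_iff.mpr hz0) hyy
  have hyj : e z j + e z j = 0 := congrFun hyy j
  obtain ⟨l, hl⟩ := (hn j).exists_eq_two_pow hj hyj
  refine graphAlpha_le_of_isDicOver (n := fun i : {i // i ≠ j} => n i) (fun i => hn i) hl hj hyj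
    (hG.congr e' hy) (fun hall => ?_) (fun m hm => ⟨fun f => h₁ ⟨m + 2, by omega, ⟨f⟩⟩⟩)
    (fun m hm => ⟨fun f => h₂ ⟨m + 2, by omega, Or.inl ⟨f⟩⟩⟩) ⟨fun f => h₃ (Or.inl ⟨f⟩)⟩
    ⟨fun f => h₃ (Or.inr (Or.inl ⟨f⟩))⟩ ⟨fun f => h₃ (Or.inr (Or.inr (Or.inl ⟨f⟩)))⟩
    ⟨fun f => h₃ (Or.inr (Or.inr (Or.inr ⟨f⟩)))⟩
  have haa : (Additive.ofMul ⟨a, ha⟩ : Additive A) + .ofMul ⟨a, ha⟩ = 0 := by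
    refine (e.trans e').injective ?_
    rw [map_add, map_zero]
    exact hall _
  have ha2 : a ^ 2 = 1 := by
    rw [sq]
    exact congrArg (fun x : Additive A => (x.toMul : G)) haa
  have := Nat.le_of_dvd (by omega) (orderOf_dvd_of_pow_eq_one ha2)
  omega
end

section
/- For every r ≥ 3, the generalised quaternion group Q_{2^r} of order 2^r satisfies α(Q_{2^r}) = 2^{r+1}. -/
open QuaternionGroup

lemma QuaternionGroup.inv_a {n : ℕ} (i : ZMod (2 * n)) :
    (a i : QuaternionGroup n)⁻¹ = a (-i) := rfl

lemma QuaternionGroup.inv_xa {n : ℕ} (i : ZMod (2 * n)) :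
    (xa i : QuaternionGroup n)⁻¹ = xa ((n : ZMod (2 * n)) + i) := rfl

section LowerBound

variable {s : ℕ}

lemma ZMod.eq_natCast_of_two_mul_eq_zero {n : ℕ} [NeZero n] {j : ZMod (2 * n)} (hj : j ≠ 0)
    (h : 2 * j = 0) : j = (n : ZMod (2 * n)) := by
  have hlt : j.val < 2 * n := j.val_lt
  have hpos : j.val ≠ 0 := by simpa using hj
  have hdvd : 2 * n ∣ 2 * j.val := by
    rw [← ZMod.natCast_eq_zero_iff]
    push_cast
    rwa [ZMod.natCast_zmod_val]
  obtain ⟨c, hc⟩ := Nat.dvd_of_mul_dvd_mul_left two_pos hdvd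
  have hc1 : c = 1 := by
    have h2 : c < 2 := by
      by_contra! hge
      nlinarith
    have h0 : c ≠ 0 := by
      rintro rfl
      simp_all
    omega
  rw [← ZMod.natCast_zmod_val j, hc, hc1, mul_one]

lemma ZMod.natCast_self_two_mul_ne_zero {n : ℕ} [NeZero n] : (n : ZMod (2 * n)) ≠ 0 := by
  rw [Ne, ZMod.natCast_eq_zero_iff]
  intro h
  have := Nat.le_of_dvd (NeZero.pos n) h
  have := NeZero.pos n
  omega

lemma QuaternionGroup.a_natCast_ne_one {n : ℕ} [NeZero n] :
    (a (n : ZMod (2 * n)) : QuaternionGroup n) ≠ 1 := by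
  rw [one_def]
  intro h
  exact ZMod.natCast_self_two_mul_ne_zero (a.inj h)

lemma QuaternionGroup.eq_a_of_orderOf_eq_two {n : ℕ} [NeZero n] {g : QuaternionGroup n}
    (hg : orderOf g = 2) : g = a n := by
  rcases g with j | j
  · have h1 : (a j : QuaternionGroup n) ≠ 1 := by
      intro h
      rw [h, orderOf_one] at hg
      omega
    have h2 : (a j : QuaternionGroup n) ^ 2 = 1 := hg ▸ pow_orderOf_eq_one _
    rw [sq, a_mul_a, one_def] at h2
    rw [one_def] at h1
    refine congrArg a (ZMod.eq_natCast_of_two_mul_eq_zero (fun h => h1 (by rw [h])) ?_)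
    exact (two_mul j).trans (a.inj h2)
  · rw [orderOf_xa] at hg
    omega

lemma QuaternionGroup.exists_pow_eq_a_two_pow {g : QuaternionGroup (2 ^ s)} (hg : g ≠ 1) :
    ∃ k : ℕ, g ^ k = a ((2 ^ s : ℕ) : ZMod (2 * 2 ^ s)) := by
  have hcard : orderOf g ∣ 2 ^ (s + 2) := by
    have := orderOf_dvd_natCard g
    rwa [Nat.card_eq_fintype_card, QuaternionGroup.card, show 4 * 2 ^ s = 2 ^ (s + 2) by ring]
      at this
  obtain ⟨k, -, hk⟩ := (Nat.dvd_prime_pow Nat.prime_two).1 hcard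
  rcases k with _ | k
  · exact absurd (orderOf_eq_one_iff.1 hk) hg
  · refine ⟨2 ^ k, eq_a_of_orderOf_eq_two ?_⟩
    rw [orderOf_pow_of_dvd (by positivity) (hk ▸ pow_dvd_pow 2 k.le_succ), hk, pow_succ,
      Nat.mul_div_cancel_left _ (by positivity)]

/-- If the central involution `z` of `Q_{2^r}` fixes every vertex off a single regular orbit, then
moving one coset of the cyclic subgroup by `z` and fixing all other vertices is a further
automorphism, so two regular orbits are needed. -/
lemma two_mul_card_le_of_aut_equiv_quaternion {V : Type*} [Fintype V] (Γ : SimpleGraph V)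
    (e : (Γ ≃g Γ) ≃* QuaternionGroup (2 ^ s)) : 2 * (4 * 2 ^ s) ≤ Fintype.card V := by
  classical
  by_contra! hlt
  set z : QuaternionGroup (2 ^ s) := a ((2 ^ s : ℕ) : ZMod (2 * 2 ^ s)) with hz
  have hz1 : z ≠ 1 := a_natCast_ne_one
  let ρ : QuaternionGroup (2 ^ s) → V → V := fun g v => e.symm g v
  have hmul (g h v) : ρ (g * h) v = ρ g (ρ h v) := by simp [ρ, RelIso.mul_apply]
  have hone (v) : ρ 1 v = v := by simp [ρ]
  have hadj (g u v) : Γ.Adj (ρ g u) (ρ g v) ↔ Γ.Adj u v := (e.symm g).map_adj_iff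
  have hext (f : Γ ≃g Γ) (v) : ρ (e f) v = f v := by simp [ρ]
  have hfix (g v) (h : ρ g v = v) (k : ℕ) : ρ (g ^ k) v = v := by
    induction k with
    | zero => rw [pow_zero, hone]
    | succ k ih => rw [pow_succ, hmul, h, ih]
  have hstab (v) (hv : ρ z v ≠ v) (g) (hg : ρ g v = v) : g = 1 := by
    by_contra hg1
    obtain ⟨k, hk⟩ := exists_pow_eq_a_two_pow hg1
    exact hv (by rw [hz, ← hk]; exact hfix g v hg k)
  have horbit (v) (hv : ρ z v ≠ v) (g h) (hgh : ρ g v = ρ h v) : g = h := by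
    have : ρ (h⁻¹ * g) v = v := by rw [hmul, hgh, ← hmul, inv_mul_cancel, hone]
    exact (inv_mul_eq_one.1 (hstab v hv _ this)).symm
  obtain ⟨v, hv⟩ : ∃ v, ρ z v ≠ v := by
    by_contra! h
    apply hz1
    rw [← map_eq_one_iff e.symm e.symm.injective]
    ext u
    exact h u
  have hoff (u) (hu : ∀ g, ρ g v ≠ u) : ρ z u = u := by
    by_contra hzu
    let F : QuaternionGroup (2 ^ s) ⊕ QuaternionGroup (2 ^ s) → V :=
      Sum.elim (fun g => ρ g v) (fun g => ρ g u)
    have hF : Function.Injective F := by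
      refine Function.Injective.sumElim (fun g h => horbit v hv g h) (fun g h => horbit u hzu g h) ?_
      intro g h hgh
      refine hu (h⁻¹ * g) ?_
      rw [hmul, hgh, ← hmul, inv_mul_cancel, hone]
    have := Fintype.card_le_of_injective F hF
    rw [Fintype.card_sum, QuaternionGroup.card] at this
    omega
  let A : Set V := {u | ∃ i, ρ (a i) v = u}
  have hzinv (u) : ρ z (ρ z u) = u := by
    rw [← hmul, hz, a_mul_a, ← Nat.cast_add, ← two_mul, ZMod.natCast_self, ← one_def, hone]
  have hzA (u) : ρ z u ∈ A ↔ u ∈ A := by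
    have key (u) (hu : u ∈ A) : ρ z u ∈ A := by
      obtain ⟨i, rfl⟩ := hu
      exact ⟨_, by rw [← hmul, hz, a_mul_a]⟩
    exact ⟨fun h => hzinv u ▸ key _ h, key u⟩
  let φ : V → V := fun u => if u ∈ A then ρ z u else u
  have hφA {u} (h : u ∈ A) : φ u = ρ z u := if_pos h
  have hφnA {u} (h : u ∉ A) : φ u = u := if_neg h
  have hφφ : Function.Involutive φ := by
    intro u
    by_cases h : u ∈ A
    · rw [hφA h, hφA ((hzA u).2 h), hzinv]
    · rw [hφnA h, hφnA h]
  have hmix (u w) (hu : u ∈ A) (hw : w ∉ A) : Γ.Adj (ρ z u) w ↔ Γ.Adj u w := by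
    by_cases h : ∃ g, ρ g v = w
    · obtain ⟨i, rfl⟩ := hu
      obtain ⟨j | j, rfl⟩ := h
      · exact absurd ⟨j, rfl⟩ hw
      · have h1 : ρ (xa j * (a i)⁻¹) (ρ (a i) v) = ρ (xa j) v := by
          rw [← hmul, inv_mul_cancel_right]
        have h2 : ρ (xa j * (a i)⁻¹) (ρ (xa j) v) = ρ z (ρ (a i) v) := by
          rw [← hmul, ← hmul]
          congr 1
          simp only [hz, inv_a, a_mul_a, xa_mul_a, xa_mul_xa]
          congr 1
          ring
        rw [← hadj (xa j * (a i)⁻¹) (ρ (a i) v), h1, h2, Γ.adj_comm]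
    · push Not at h
      conv_lhs => rw [← hoff w h]
      exact hadj z u w
  have hφadj (u w) : Γ.Adj (φ u) (φ w) ↔ Γ.Adj u w := by
    by_cases hu : u ∈ A <;> by_cases hw : w ∈ A
    · rw [hφA hu, hφA hw, hadj]
    · rw [hφA hu, hφnA hw, hmix u w hu hw]
    · rw [hφnA hu, hφA hw, Γ.adj_comm, hmix w u hw hu, Γ.adj_comm]
    · rw [hφnA hu, hφnA hw]
  let f : Γ ≃g Γ := ⟨hφφ.toPerm φ, fun {u w} => hφadj u w⟩
  have hf (u) : ρ (e f) u = φ u := hext f u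
  have hvA : v ∈ A := ⟨0, by rw [← one_def, hone]⟩
  have hxA : ρ (xa 0) v ∉ A := by
    rintro ⟨i, hi⟩
    simpa using horbit v hv _ _ hi
  have hf1 : e f = 1 := by
    have h := hf (ρ (xa 0) v)
    rw [hφnA hxA, ← hmul] at h
    exact mul_eq_right.1 (horbit v hv _ _ h)
  have h := hf v
  rw [hf1, hone, hφA hvA] at h
  exact hv h.symm

end LowerBound

section UpperBound

variable {n : ℕ}

lemma ZMod.natCast_add_self_eq_zero : (n : ZMod (2 * n)) + n = 0 := by
  rw [← Nat.cast_add, ← two_mul, ZMod.natCast_self]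

lemma ZMod.natCast_ne_natCast_of_lt {k l : ℕ} (hk : k < 2 * n) (hl : l < 2 * n) (h : k ≠ l) :
    (k : ZMod (2 * n)) ≠ l := by
  rw [Ne, ZMod.natCast_eq_natCast_iff', Nat.mod_eq_of_lt hk, Nat.mod_eq_of_lt hl]
  exact h

/-- With `x = a 1` and `y = xa 0` the generators of the dicyclic group, `inl g` is adjacent to
`inl (g x^{±1})`, `inr g` is adjacent to `inr (g y^{±1})` and `inr (g y²)`, and `inl g` is adjacent
to `inr g`, `inr (g x⁻¹)` and `inr (g y⁻¹)`. -/
def quaternionAdj :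
    QuaternionGroup n ⊕ QuaternionGroup n → QuaternionGroup n ⊕ QuaternionGroup n → Prop
  | .inl g, .inl h => g⁻¹ * h = a 1 ∨ g⁻¹ * h = a (-1)
  | .inr g, .inr h => g⁻¹ * h = xa 0 ∨ g⁻¹ * h = xa n ∨ g⁻¹ * h = a n
  | .inl g, .inr h => g⁻¹ * h = a 0 ∨ g⁻¹ * h = a (-1) ∨ g⁻¹ * h = xa n
  | .inr h, .inl g => g⁻¹ * h = a 0 ∨ g⁻¹ * h = a (-1) ∨ g⁻¹ * h = xa n

lemma inv_mul_eq_iff_swap {G : Type*} [Group G] {g h c d : G} (hcd : c⁻¹ = d) :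
    g⁻¹ * h = c ↔ h⁻¹ * g = d := by
  rw [← hcd, ← inv_inj, mul_inv_rev, inv_inv]

/-- The graph of `quaternionAdj`. -/
def quaternionGraph (hn : 2 ≤ n) : SimpleGraph (QuaternionGroup n ⊕ QuaternionGroup n) where
  Adj := quaternionAdj
  symm := ⟨by
    have hnn : -(n : ZMod (2 * n)) = n := neg_eq_of_add_eq_zero_left ZMod.natCast_add_self_eq_zero
    rintro (g | g) (h | h) H
    · simp only [quaternionAdj] at H ⊢
      rw [inv_mul_eq_iff_swap (g := h) (inv_a 1), inv_mul_eq_iff_swap (g := h) (inv_a (-1)),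
        neg_neg, or_comm]
      exact H
    · exact H
    · exact H
    · simp only [quaternionAdj] at H ⊢
      rw [inv_mul_eq_iff_swap (g := h) (inv_xa 0), inv_mul_eq_iff_swap (g := h) (inv_xa _),
        inv_mul_eq_iff_swap (g := h) (inv_a _), ZMod.natCast_add_self_eq_zero, hnn, add_zero]
      tauto⟩
  loopless := ⟨by
    have : NeZero n := ⟨by omega⟩
    have h1 : (0 : ZMod (2 * n)) ≠ 1 := by
      simpa using ZMod.natCast_ne_natCast_of_lt (n := n) (k := 0) (l := 1) (by omega) (by omega)
    have h2 := ZMod.natCast_self_two_mul_ne_zero (n := n)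
    rintro (g | g) H
    · simp only [quaternionAdj, inv_mul_cancel, one_def, a.injEq, zero_eq_neg] at H
      simp [h1, h1.symm] at H
    · simp only [quaternionAdj, inv_mul_cancel] at H
      simp [-a_zero, one_def, h2.symm] at H⟩

variable (hn : 2 ≤ n)

/-- Left translation by `g`, as an automorphism of `quaternionGraph`. -/
def quaternionTranslate (g : QuaternionGroup n) : quaternionGraph hn ≃g quaternionGraph hn where
  toEquiv := Equiv.sumCongr (Equiv.mulLeft g) (Equiv.mulLeft g)
  map_rel_iff' := by
    rintro (x | x) (y | y) <;> simp [quaternionGraph, quaternionAdj, mul_assoc]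

lemma quaternionTranslate_inl (g h : QuaternionGroup n) :
    quaternionTranslate hn g (.inl h) = .inl (g * h) := rfl

lemma quaternionTranslate_inr (g h : QuaternionGroup n) :
    quaternionTranslate hn g (.inr h) = .inr (g * h) := rfl

/-- Left translation, as a group homomorphism. -/
def quaternionTranslateHom :
    QuaternionGroup n →* (quaternionGraph hn ≃g quaternionGraph hn) where
  toFun := quaternionTranslate hn
  map_one' := by
    ext (x | x) <;> simp [quaternionTranslate_inl, quaternionTranslate_inr]
  map_mul' g h := by
    ext (x | x) <;>
      simp [quaternionTranslate_inl, quaternionTranslate_inr, RelIso.mul_apply, mul_assoc]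

lemma quaternionGraph_adj_inl_one_iff (v : QuaternionGroup n ⊕ QuaternionGroup n) :
    (quaternionGraph hn).Adj (.inl 1) v ↔
      v = .inl (a 1) ∨ v = .inl (a (-1)) ∨ v = .inr 1 ∨ v = .inr (a (-1)) ∨ v = .inr (xa n) := by
  rcases v with g | g <;> simp [quaternionGraph, quaternionAdj]

lemma quaternionGraph_adj_inr_one_iff (v : QuaternionGroup n ⊕ QuaternionGroup n) :
    (quaternionGraph hn).Adj (.inr 1) v ↔
      v = .inl 1 ∨ v = .inl (a 1) ∨ v = .inl (xa 0) ∨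
        v = .inr (xa 0) ∨ v = .inr (xa n) ∨ v = .inr (a n) := by
  rcases v with g | g
  · simp only [quaternionGraph, quaternionAdj, mul_one, Sum.inl.injEq, reduceCtorEq, or_false]
    rw [inv_eq_iff_eq_inv, inv_eq_iff_eq_inv, inv_eq_iff_eq_inv, inv_a, inv_a, inv_xa, neg_zero,
      neg_neg, ZMod.natCast_add_self_eq_zero, one_def]
  · simp [quaternionGraph, quaternionAdj]

lemma quaternionGraph_iso_inl (ψ : quaternionGraph hn ≃g quaternionGraph hn)
    (g : QuaternionGroup n) : ∃ h, ψ (.inl g) = .inl h := by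
  classical
  have : NeZero n := ⟨by omega⟩
  have hl (g) : (quaternionGraph hn).degree (.inl g) ≤ 5 := by
    rw [show (.inl g : QuaternionGroup n ⊕ QuaternionGroup n) = quaternionTranslate hn g (.inl 1) by
      simp [quaternionTranslate_inl], SimpleGraph.Iso.degree_eq,
      ← SimpleGraph.card_neighborFinset_eq_degree]
    refine (Finset.card_le_card (t := {.inl (a 1), .inl (a (-1)), .inr 1, .inr (a (-1)),
      .inr (xa n)}) fun v hv => ?_).trans Finset.card_le_five
    rw [SimpleGraph.mem_neighborFinset, quaternionGraph_adj_inl_one_iff] at hv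
    simpa using hv
  have hr (g) : 6 ≤ (quaternionGraph hn).degree (.inr g) := by
    rw [show (.inr g : QuaternionGroup n ⊕ QuaternionGroup n) = quaternionTranslate hn g (.inr 1) by
      simp [quaternionTranslate_inr], SimpleGraph.Iso.degree_eq,
      ← SimpleGraph.card_neighborFinset_eq_degree]
    have h1 : (0 : ZMod (2 * n)) ≠ 1 := by
      simpa using ZMod.natCast_ne_natCast_of_lt (n := n) (k := 0) (l := 1) (by omega) (by omega)
    have h2 := ZMod.natCast_self_two_mul_ne_zero (n := n)
    have h6 : Finset.card ({.inl 1, .inl (a 1), .inl (xa 0), .inr (xa 0), .inr (xa n),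
        .inr (a n)} : Finset (QuaternionGroup n ⊕ QuaternionGroup n)) = 6 := by
      simp [-a_zero, Finset.card_insert_of_notMem, one_def, h1, h2.symm]
    rw [← h6]
    refine Finset.card_le_card fun v hv => ?_
    rw [SimpleGraph.mem_neighborFinset, quaternionGraph_adj_inr_one_iff]
    simpa using hv
  rcases hψ : ψ (.inl g) with h | h
  · exact ⟨h, rfl⟩
  · have := hl g
    rw [← SimpleGraph.Iso.degree_eq ψ, hψ] at this
    have := hr h
    omega

lemma quaternionGraph_iso_inr (ψ : quaternionGraph hn ≃g quaternionGraph hn)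
    (g : QuaternionGroup n) : ∃ h, ψ (.inr g) = .inr h := by
  rcases hψ : ψ (.inr g) with h | h
  · obtain ⟨k, hk⟩ := quaternionGraph_iso_inl hn ψ.symm h
    rw [← hψ, RelIso.symm_apply_apply] at hk
    exact absurd hk (by simp)
  · exact ⟨h, rfl⟩

/-- The neighbours of `inl 1` induce a path `inl x, inr 1, inr y⁻¹` and an edge
`inl x⁻¹, inr x⁻¹`, which leaves no freedom. -/
lemma quaternionGraph_iso_fix_near_one (ψ : quaternionGraph hn ≃g quaternionGraph hn)
    (h : ψ (.inl 1) = .inl 1) :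
    ψ (.inl (a 1)) = .inl (a 1) ∧ ψ (.inr 1) = .inr 1 := by
  have : NeZero n := ⟨by omega⟩
  have h1 : (0 : ZMod (2 * n)) ≠ 1 := by
    simpa using ZMod.natCast_ne_natCast_of_lt (n := n) (k := 0) (l := 1) (by omega) (by omega)
  have h2 : (0 : ZMod (2 * n)) ≠ 1 + 1 := by
    have := ZMod.natCast_ne_natCast_of_lt (n := n) (k := 0) (l := 2) (by omega) (by omega)
      (by omega)
    push_cast at this
    rwa [one_add_one_eq_two]
  have h3 : (1 : ZMod (2 * n)) ≠ n := by
    simpa using ZMod.natCast_ne_natCast_of_lt (n := n) (k := 1) (l := n) (by omega) (by omega)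
      (by omega)
  have adj_l : (quaternionGraph hn).Adj (.inl (a 1)) (.inr 1) := by
    simp [quaternionGraph, quaternionAdj, inv_a]
  have adj_r : (quaternionGraph hn).Adj (.inr 1) (.inr (xa n)) := by
    simp [quaternionGraph, quaternionAdj]
  have not1 : ¬ (quaternionGraph hn).Adj (.inl (a 1)) (.inr (a (-1))) := by
    simp only [quaternionGraph, quaternionAdj, inv_a, a_mul_a, a.injEq, reduceCtorEq, or_false]
    rintro (h | h)
    · exact h2 (by linear_combination h)
    · exact h1 (by linear_combination h)
  have not2 : ¬ (quaternionGraph hn).Adj (.inl (a 1)) (.inr (xa n)) := by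
    simp only [quaternionGraph, quaternionAdj, inv_a, a_mul_xa, xa.injEq, reduceCtorEq, false_or]
    intro h
    exact h1 (by linear_combination -h)
  have not3 : ¬ (quaternionGraph hn).Adj (.inl (a (-1))) (.inr 1) := by
    simp only [quaternionGraph, quaternionAdj, inv_a, one_def, a_mul_a, a.injEq, reduceCtorEq,
      or_false]
    rintro (h | h)
    · exact h1 (by linear_combination -h)
    · exact h2 (by linear_combination -h)
  have not4 : ¬ (quaternionGraph hn).Adj (.inl (a (-1))) (.inr (xa n)) := by
    simp only [quaternionGraph, quaternionAdj, inv_a, a_mul_xa, xa.injEq, reduceCtorEq, false_or]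
    intro h
    exact h1 (by linear_combination h)
  have not5 : ¬ (quaternionGraph hn).Adj (.inr (a (-1))) (.inr 1) := by
    simp only [quaternionGraph, quaternionAdj, inv_a, one_def, a_mul_a, a.injEq, reduceCtorEq,
      false_or]
    intro h
    exact h3 (by linear_combination h)
  have not6 : ¬ (quaternionGraph hn).Adj (.inr (a (-1))) (.inr (xa n)) := by
    simp only [quaternionGraph, quaternionAdj, inv_a, a_mul_xa, xa.injEq, reduceCtorEq, or_false]
    rintro (h | h)
    · exact h3 (by linear_combination -h)
    · exact h1 (by linear_combination h)
  have himg (v) (hv : (quaternionGraph hn).Adj (.inl 1) v) :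
      (quaternionGraph hn).Adj (.inl 1) (ψ v) := by
    rwa [← ψ.map_adj_iff, h] at hv
  obtain ⟨x, hx⟩ := quaternionGraph_iso_inl hn ψ (a 1)
  obtain ⟨p, hp⟩ := quaternionGraph_iso_inr hn ψ 1
  obtain ⟨q, hq⟩ := quaternionGraph_iso_inr hn ψ (xa n)
  have hx' := himg (.inl (a 1)) (by simp [quaternionGraph_adj_inl_one_iff])
  have hp' := himg (.inr 1) (by simp [quaternionGraph_adj_inl_one_iff])
  have hq' := himg (.inr (xa n)) (by simp [quaternionGraph_adj_inl_one_iff])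
  rw [quaternionGraph_adj_inl_one_iff] at hx' hp' hq'
  rw [← ψ.map_adj_iff] at adj_l adj_r
  rw [hx] at hx' adj_l
  rw [hp] at hp' adj_l adj_r
  rw [hq] at hq' adj_r
  simp only [Sum.inl.injEq, Sum.inr.injEq, reduceCtorEq, or_false, false_or] at hx' hp' hq'
  rw [hx, hp]
  rcases hx' with rfl | rfl
  · rcases hp' with rfl | rfl | rfl
    · exact ⟨rfl, rfl⟩
    · exact absurd adj_l not1
    · exact absurd adj_l not2
  · rcases hp' with rfl | rfl | rfl
    · exact absurd adj_l not3
    · rcases hq' with rfl | rfl | rfl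
      · exact absurd adj_r not5
      · exact absurd adj_r (SimpleGraph.irrefl _)
      · exact absurd adj_r not6
    · exact absurd adj_l not4

lemma quaternionGraph_iso_fix_near (ψ : quaternionGraph hn ≃g quaternionGraph hn)
    (g : QuaternionGroup n) (h : ψ (.inl g) = .inl g) :
    ψ (.inl (g * a 1)) = .inl (g * a 1) ∧ ψ (.inr g) = .inr g ∧
      ψ (.inl (g * xa 0)) = .inl (g * xa 0) := by
  set χ := quaternionTranslate hn g⁻¹ * ψ * quaternionTranslate hn g with hχ
  have hl (k) (hk : χ (.inl k) = .inl k) : ψ (.inl (g * k)) = .inl (g * k) := by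
    refine (quaternionTranslate hn g⁻¹).injective (Eq.trans hk ?_)
    rw [quaternionTranslate_inl, inv_mul_cancel_left]
  have hr (k) (hk : χ (.inr k) = .inr k) : ψ (.inr (g * k)) = .inr (g * k) := by
    refine (quaternionTranslate hn g⁻¹).injective (Eq.trans hk ?_)
    rw [quaternionTranslate_inr, inv_mul_cancel_left]
  have h0 : χ (.inl 1) = .inl 1 := by
    simp [hχ, RelIso.mul_apply, quaternionTranslate_inl, h]
  obtain ⟨h1, h2⟩ := quaternionGraph_iso_fix_near_one hn χ h0
  refine ⟨hl _ h1, by simpa using hr _ h2, hl _ ?_⟩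
  obtain ⟨x, hx⟩ := quaternionGraph_iso_inl hn χ (xa 0)
  have hadj : (quaternionGraph hn).Adj (.inr 1) (.inl (xa 0)) := by
    simp [quaternionGraph_adj_inr_one_iff]
  rw [← χ.map_adj_iff, h2, hx, quaternionGraph_adj_inr_one_iff] at hadj
  simp only [Sum.inl.injEq, reduceCtorEq, or_false] at hadj
  rcases hadj with rfl | rfl | rfl
  · rw [← h0] at hx
    exact absurd (χ.injective hx) (by simp [-a_zero, one_def])
  · rw [← h1] at hx
    exact absurd (χ.injective hx) (by simp)
  · exact hx

lemma quaternionGraph_iso_eq_one (ψ : quaternionGraph hn ≃g quaternionGraph hn)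
    (h : ψ (.inl 1) = .inl 1) : ψ = 1 := by
  have : NeZero n := ⟨by omega⟩
  have ha (k : ℕ) : ψ (.inl (a k)) = .inl (a k) := by
    induction k with
    | zero => simpa using h
    | succ k ih => simpa [a_mul_a] using (quaternionGraph_iso_fix_near hn ψ _ ih).1
  have ha' (i) : ψ (.inl (a i)) = .inl (a i) := by
    simpa using ha i.val
  have hl (g) : ψ (.inl g) = .inl g := by
    rcases g with i | i
    · exact ha' i
    · simpa [a_mul_xa] using (quaternionGraph_iso_fix_near hn ψ _ (ha' (-i))).2.2
  ext (g | g)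
  · exact hl g
  · exact (quaternionGraph_iso_fix_near hn ψ g (hl g)).2.1

lemma quaternionTranslateHom_bijective : Function.Bijective (quaternionTranslateHom hn) := by
  constructor
  · intro g h hgh
    have := DFunLike.congr_fun hgh (.inl 1)
    simpa [quaternionTranslateHom, quaternionTranslate_inl] using this
  · intro ψ
    obtain ⟨g, hg⟩ := quaternionGraph_iso_inl hn ψ 1
    refine ⟨g, ?_⟩
    have := quaternionGraph_iso_eq_one hn ((quaternionTranslateHom hn g)⁻¹ * ψ) (by
      rw [← map_inv, RelIso.mul_apply, hg]
      simp [quaternionTranslateHom, quaternionTranslate_inl])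
    exact inv_mul_eq_one.1 this

end UpperBound

/-- Isomorphic graphs have isomorphic automorphism groups. -/
def SimpleGraph.Iso.autCongr {V W : Type*} {Γ : SimpleGraph V} {Δ : SimpleGraph W} (i : Γ ≃g Δ) :
    (Γ ≃g Γ) ≃* (Δ ≃g Δ) where
  toFun f := (i.symm.trans f).trans i
  invFun f := (i.trans f).trans i.symm
  left_inv f := by ext; simp
  right_inv f := by ext; simp
  map_mul' f g := by ext; simp [RelIso.mul_apply]

/-- Proposition: the generalised quaternion group `Q_{2^r}` of order `2^r`
(`r ≥ 3`), realised as `QuaternionGroup (2 ^ (r - 2))`, satisfies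
`α(Q_{2^r}) = 2^(r+1)`. -/
theorem alpha_generalizedQuaternion (r : ℕ) (hr : 3 ≤ r) :
    graphAlpha (QuaternionGroup (2 ^ (r - 2))) = 2 ^ (r + 1) := by
  obtain ⟨s, rfl⟩ : ∃ s, r = s + 2 := ⟨r - 2, by omega⟩
  rw [Nat.add_sub_cancel]
  have hpow : 2 ^ (s + 2 + 1) = 2 * (4 * 2 ^ s) := by ring
  have hn : 2 ≤ 2 ^ s := Nat.le_self_pow (by omega) 2
  have hmem : 2 ^ (s + 2 + 1) ∈
      {n : ℕ | ∃ Γ : SimpleGraph (Fin n), Nonempty ((Γ ≃g Γ) ≃* QuaternionGroup (2 ^ s))} := by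
    have hcard : Fintype.card (QuaternionGroup (2 ^ s) ⊕ QuaternionGroup (2 ^ s)) =
        2 ^ (s + 2 + 1) := by
      rw [Fintype.card_sum, QuaternionGroup.card, hpow, two_mul]
    let i := SimpleGraph.Iso.map (Fintype.equivFinOfCardEq hcard) (quaternionGraph hn)
    exact ⟨_, ⟨i.autCongr.symm.trans
      (MulEquiv.ofBijective _ (quaternionTranslateHom_bijective hn)).symm⟩⟩
  refine le_antisymm (Nat.sInf_le hmem) (le_csInf ⟨_, hmem⟩ ?_)
  rintro k ⟨Γ, ⟨e⟩⟩
  rw [hpow]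
  simpa using two_mul_card_le_of_aut_equiv_quaternion Γ e
end

section
/- For q ∈ {3, 5}, the dicyclic group Dic_q of order 4q satisfies α(Dic_q) = 3q + 8; that is, α(Dic₃) = 17 and α(Dic₅) = 23. -/
section

open QuaternionGroup

theorem exists_involution_extend {α V : Type*} {Γ : SimpleGraph V} {ι : α → V}
    (hι : Function.Injective ι) {τ : α → α} (hτ : Function.Involutive τ)
    (h_in : ∀ x y, Γ.Adj (ι (τ x)) (ι (τ y)) ↔ Γ.Adj (ι x) (ι y))
    (h_out : ∀ x, ∀ u ∉ Set.range ι, Γ.Adj u (ι (τ x)) ↔ Γ.Adj u (ι x)) :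
    ∃ σ : Γ ≃g Γ, σ * σ = 1 ∧ (∀ x, σ (ι x) = ι (τ x)) ∧ ∀ u ∉ Set.range ι, σ u = u := by
  classical
  obtain ⟨f, hf_in, hf_out⟩ : ∃ f : V → V, (∀ x, f (ι x) = ι (τ x)) ∧ ∀ u ∉ Set.range ι, f u = u :=
    ⟨Function.extend ι (ι ∘ τ) id, fun x => hι.extend_apply _ _ x,
      fun u hu => Function.extend_apply' _ _ u hu⟩
  have hf : Function.Involutive f := fun v => by
    by_cases hv : v ∈ Set.range ι
    · obtain ⟨x, rfl⟩ := hv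
      rw [hf_in, hf_in, hτ]
    · rw [hf_out v hv, hf_out v hv]
  have hadj : ∀ u v, Γ.Adj (f u) (f v) ↔ Γ.Adj u v := fun u v => by
    by_cases hu : u ∈ Set.range ι <;> by_cases hv : v ∈ Set.range ι
    · obtain ⟨x, rfl⟩ := hu
      obtain ⟨y, rfl⟩ := hv
      rw [hf_in, hf_in, h_in]
    · obtain ⟨x, rfl⟩ := hu
      rw [hf_in, hf_out v hv, Γ.adj_comm, h_out x v hv, Γ.adj_comm]
    · obtain ⟨y, rfl⟩ := hv
      rw [hf_in, hf_out u hu, h_out y u hu]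
    · rw [hf_out u hu, hf_out v hv]
  exact ⟨⟨hf.toPerm f, hadj _ _⟩, RelIso.ext hf, hf_in, hf_out⟩

theorem smul_pow_eq {G V : Type*} [Group G] [MulAction G V] {g : G} {v : V} (h : g • v = v)
    (k : ℕ) : g ^ k • v = v :=
  (MulAction.stabilizer G v).pow_mem h k

namespace QuaternionGroup

variable {q : ℕ}

/-- The cyclic subgroup of order `q` of the dicyclic group (for odd `q`). -/
def rot (i : ZMod q) : QuaternionGroup q := a 2 ^ i.val

/-- A cyclic subgroup of order `4` of the dicyclic group. -/
def quarter (j : ZMod 4) : QuaternionGroup q := xa 0 ^ j.val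

/-- The quotient map of the dicyclic group by `rot`, for odd `q`. -/
def toQuarter : QuaternionGroup q → ZMod 4
  | a i => 2 * i.val
  | xa i => 1 + 2 * i.val

/-- The automorphism fixing the powers of `a` and inverting all other elements. -/
def flipInv : QuaternionGroup q → QuaternionGroup q
  | a i => a i
  | xa i => (xa i)⁻¹

theorem rot_add (hq : q = 3 ∨ q = 5) : ∀ i j : ZMod q, rot (i + j) = rot i * rot j := by
  rcases hq with rfl | rfl <;> decide +kernel

theorem rot_one (hq : q = 3 ∨ q = 5) : rot (1 : ZMod q) = a 2 := by
  rcases hq with rfl | rfl <;> decide +kernel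

theorem exists_rot_pow (hq : q = 3 ∨ q = 5) :
    ∀ i : ZMod q, i ≠ 0 → ∃ k < 5, rot i ^ k = a 2 := by
  rcases hq with rfl | rfl <;> decide +kernel

theorem quarter_add (hq : q = 3 ∨ q = 5) :
    ∀ i j : ZMod 4, (quarter (i + j) : QuaternionGroup q) = quarter i * quarter j := by
  rcases hq with rfl | rfl <;> decide +kernel

theorem exists_quarter_pow (hq : q = 3 ∨ q = 5) :
    ∀ j : ZMod 4, j ≠ 0 → ∃ k < 4, (quarter j : QuaternionGroup q) ^ k = a q := by
  rcases hq with rfl | rfl <;> decide +kernel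

theorem exists_pow_eq (hq : q = 3 ∨ q = 5) :
    ∀ g : QuaternionGroup q, g ≠ 1 → ∃ k < 6, g ^ k = a q ∨ g ^ k = a 2 := by
  rcases hq with rfl | rfl <;> decide +kernel

theorem eq_a_of_mul_self (hq : q = 3 ∨ q = 5) :
    ∀ g : QuaternionGroup q, g * g = 1 → g ≠ 1 → g = a q := by
  rcases hq with rfl | rfl <;> decide +kernel

theorem a_self_ne_one (hq : q = 3 ∨ q = 5) : (a q : QuaternionGroup q) ≠ 1 := by
  rcases hq with rfl | rfl <;> decide +kernel

theorem a_two_ne_one (hq : q = 3 ∨ q = 5) : (a 2 : QuaternionGroup q) ≠ 1 := by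
  rcases hq with rfl | rfl <;> decide +kernel

theorem mul_a_self (hq : q = 3 ∨ q = 5) : ∀ g : QuaternionGroup q, g * a q = a q * g := by
  rcases hq with rfl | rfl <;> decide +kernel

theorem flipInv_flipInv (hq : q = 3 ∨ q = 5) : ∀ g : QuaternionGroup q, flipInv (flipInv g) = g := by
  rcases hq with rfl | rfl <;> decide +kernel

theorem flipInv_eq (hq : q = 3 ∨ q = 5) :
    ∀ g : QuaternionGroup q, flipInv g = g ∨ flipInv g = g * a q := by
  rcases hq with rfl | rfl <;> decide +kernel

theorem inv_flipInv_mul_flipInv (hq : q = 3 ∨ q = 5) : ∀ g h : QuaternionGroup q,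
    (flipInv g)⁻¹ * flipInv h = g⁻¹ * h ∨ (flipInv g)⁻¹ * flipInv h = (g⁻¹ * h)⁻¹ := by
  rcases hq with rfl | rfl <;> decide +kernel

theorem exists_flipInv_ne (hq : q = 3 ∨ q = 5) : ∃ g : QuaternionGroup q, flipInv g ≠ g := by
  rcases hq with rfl | rfl <;> decide +kernel

theorem exists_inv_mul_quarter (hq : q = 3 ∨ q = 5) : ∀ (g : QuaternionGroup q) (j : ZMod 4),
    ∃ i : ZMod q, g⁻¹ * quarter j = quarter (j - toQuarter g) * rot i := by
  rcases hq with rfl | rfl <;> decide +kernel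

theorem toQuarter_flipInv (hq : q = 3 ∨ q = 5) :
    ∀ g : QuaternionGroup q, toQuarter (flipInv g) = -toQuarter g := by
  rcases hq with rfl | rfl <;> decide +kernel

end QuaternionGroup

theorem ZMod.exists_reflection_four : ∀ T : ZMod 4 → Bool, ∃ c, ∀ i, T (c - i) = T i := by
  decide +kernel

theorem ZMod.exists_reflection {q : ℕ} (hq : q = 3 ∨ q = 5) :
    ∀ T : ZMod q → Bool, ∃ c, ∀ i, T (c - i) = T i := by
  rcases hq with rfl | rfl <;> decide +kernel

/-- An action of the dicyclic group by automorphisms of `Γ` for which every involution of `Γ`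
comes from the unique involution of the group. -/
structure IsInvolutionRigid {q : ℕ} {V : Type*} [MulAction (QuaternionGroup q) V]
    (Γ : SimpleGraph V) : Prop where
  adj_smul : ∀ (g : QuaternionGroup q) (u v : V), Γ.Adj (g • u) (g • v) ↔ Γ.Adj u v
  eq_of_involution : ∀ σ : Γ ≃g Γ, σ * σ = 1 → σ = 1 ∨
    ∀ v, σ v = (a q : QuaternionGroup q) • v

section Action

variable {q : ℕ} {V : Type*} [MulAction (QuaternionGroup q) V]

theorem eq_of_forall_rot_smul {u : V} (hu : (a 2 : QuaternionGroup q) • u = u) (i : ZMod q) :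
    rot i • u = u :=
  smul_pow_eq hu _

theorem smul_left_injective_of_moved (hq : q = 3 ∨ q = 5) {v : V}
    (hz : (a q : QuaternionGroup q) • v ≠ v) (hr : (a 2 : QuaternionGroup q) • v ≠ v) :
    Function.Injective fun g : QuaternionGroup q => g • v := by
  intro g h hgh
  by_contra hne
  obtain ⟨k, -, hk⟩ := exists_pow_eq hq (g⁻¹ * h) (by rwa [Ne, inv_mul_eq_one])
  have := smul_pow_eq (g := g⁻¹ * h) (v := v) (by rw [mul_smul, inv_smul_eq_iff]; exact hgh.symm) k
  rcases hk with hk | hk <;> rw [hk] at this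
  exacts [hz this, hr this]

theorem quarter_smul_eq_iff (hq : q = 3 ∨ q = 5) {i j : ZMod 4} {u v : V} :
    (quarter i : QuaternionGroup q) • u = (quarter j : QuaternionGroup q) • v ↔
      u = (quarter (j - i) : QuaternionGroup q) • v := by
  rw [← smul_left_cancel_iff (quarter i : QuaternionGroup q) (x := u), ← mul_smul,
    ← quarter_add hq, add_sub_cancel]

theorem rot_smul_eq_iff (hq : q = 3 ∨ q = 5) {i j : ZMod q} {u v : V} :
    rot i • u = rot j • v ↔ u = rot (j - i) • v := by
  rw [← smul_left_cancel_iff (rot i) (x := u), ← mul_smul, ← rot_add hq, add_sub_cancel]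

theorem quarter_smul_injective (hq : q = 3 ∨ q = 5) {v : V}
    (hz : (a q : QuaternionGroup q) • v ≠ v) :
    Function.Injective fun j : ZMod 4 => (quarter j : QuaternionGroup q) • v := by
  intro i j hij
  by_contra hne
  obtain ⟨k, -, hk⟩ := exists_quarter_pow hq (j - i) (sub_ne_zero.2 (Ne.symm hne))
  exact hz (hk ▸ smul_pow_eq ((quarter_smul_eq_iff hq).1 hij).symm k)

theorem rot_smul_injective (hq : q = 3 ∨ q = 5) {v : V}
    (hr : (a 2 : QuaternionGroup q) • v ≠ v) :
    Function.Injective fun i : ZMod q => rot i • v := by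
  intro i j hij
  by_contra hne
  obtain ⟨k, -, hk⟩ := exists_rot_pow hq (j - i) (sub_ne_zero.2 (Ne.symm hne))
  exact hr (hk ▸ smul_pow_eq ((rot_smul_eq_iff hq).1 hij).symm k)

theorem injective_rot_family (hq : q = 3 ∨ q = 5) {J : Type*} {x : J → V}
    (hr : ∀ j, (a 2 : QuaternionGroup q) • x j ≠ x j)
    (hx : ∀ j k, j ≠ k → ∀ i : ZMod q, x j ≠ rot i • x k) :
    Function.Injective fun p : J × ZMod q => rot p.2 • x p.1 := by
  rintro ⟨j, i⟩ ⟨k, l⟩ h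
  obtain rfl : j = k := by
    by_contra hjk
    exact hx j k hjk _ ((rot_smul_eq_iff hq).1 h)
  exact congrArg (Prod.mk j) (rot_smul_injective hq (hr j) h)

theorem injective_quarter_family (hq : q = 3 ∨ q = 5) {J : Type*} {x : J → V}
    (hz : ∀ j, (a q : QuaternionGroup q) • x j ≠ x j)
    (hx : ∀ j k, j ≠ k → ∀ i : ZMod 4, x j ≠ (quarter i : QuaternionGroup q) • x k) :
    Function.Injective fun p : J × ZMod 4 => (quarter p.2 : QuaternionGroup q) • x p.1 := by
  rintro ⟨j, i⟩ ⟨k, l⟩ h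
  obtain rfl : j = k := by
    by_contra hjk
    exact hx j k hjk _ ((quarter_smul_eq_iff hq).1 h)
  exact congrArg (Prod.mk j) (quarter_smul_injective hq (hz j) h)

theorem a_smul_smul_ne (hq : q = 3 ∨ q = 5) {v : V} {g : QuaternionGroup q}
    (hz : (a q : QuaternionGroup q) • v ≠ v) : (a q : QuaternionGroup q) • g • v ≠ g • v := by
  rwa [← mul_smul, ← mul_a_self hq, mul_smul, Ne, smul_left_cancel_iff]

theorem a_two_smul_rot_smul_ne (hq : q = 3 ∨ q = 5) {v : V}
    (hr : (a 2 : QuaternionGroup q) • v ≠ v) (i : ZMod q) :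
    (a 2 : QuaternionGroup q) • rot i • v ≠ rot i • v := by
  rw [← rot_one hq] at hr ⊢
  rwa [← mul_smul, ← rot_add hq, add_comm, rot_add hq, mul_smul, Ne, smul_left_cancel_iff]

variable {Γ : SimpleGraph V}

namespace IsInvolutionRigid

theorem smul_eq_of_involution (H : IsInvolutionRigid (q := q) Γ) {α : Type*} {ι : α → V}
    (hι : Function.Injective ι) {τ : α → α} (hτ : Function.Involutive τ)
    (h_in : ∀ x y, Γ.Adj (ι (τ x)) (ι (τ y)) ↔ Γ.Adj (ι x) (ι y))
    (h_out : ∀ x, ∀ u ∉ Set.range ι, Γ.Adj u (ι (τ x)) ↔ Γ.Adj u (ι x)) (hne : ∃ x, τ x ≠ x) :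
    (∀ x, ι (τ x) = (a q : QuaternionGroup q) • ι x) ∧
      ∀ u ∉ Set.range ι, (a q : QuaternionGroup q) • u = u := by
  obtain ⟨σ, hσ, hσ_in, hσ_out⟩ := exists_involution_extend hι hτ h_in h_out
  rcases H.eq_of_involution σ hσ with rfl | h
  · obtain ⟨x, hx⟩ := hne
    exact (hx (hι (hσ_in x).symm)).elim
  · exact ⟨fun x => by rw [← hσ_in, h], fun u hu => by rw [← h, hσ_out u hu]⟩

theorem adj_smul_left (H : IsInvolutionRigid (q := q) Γ) (g : QuaternionGroup q) (u v : V) :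
    Γ.Adj (g • u) v ↔ Γ.Adj u (g⁻¹ • v) := by
  rw [← H.adj_smul g u, smul_inv_smul]

theorem adj_smul_right_of_fixed (H : IsInvolutionRigid (q := q) Γ) {g : QuaternionGroup q} {u : V}
    (hu : g • u = u) (v : V) : Γ.Adj u (g • v) ↔ Γ.Adj u v := by
  conv_lhs => rw [← hu]
  exact H.adj_smul g u v

theorem adj_rot_smul (H : IsInvolutionRigid (q := q) Γ) (hq : q = 3 ∨ q = 5) (i j : ZMod q)
    (u v : V) : Γ.Adj (rot i • u) (rot j • v) ↔ Γ.Adj u (rot (j - i) • v) := by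
  rw [← H.adj_smul (rot i) u, ← mul_smul, ← rot_add hq, add_sub_cancel]

theorem adj_quarter_smul (H : IsInvolutionRigid (q := q) Γ) (hq : q = 3 ∨ q = 5) (i j : ZMod 4)
    (u v : V) : Γ.Adj ((quarter i : QuaternionGroup q) • u) ((quarter j : QuaternionGroup q) • v) ↔
      Γ.Adj u ((quarter (j - i) : QuaternionGroup q) • v) := by
  rw [← H.adj_smul (quarter i) u, ← mul_smul, ← quarter_add hq, add_sub_cancel]

theorem adj_quarter_reflect (H : IsInvolutionRigid (q := q) Γ) (hq : q = 3 ∨ q = 5)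
    (c i j : ZMod 4) (v : V) :
    Γ.Adj ((quarter (c - i) : QuaternionGroup q) • v) ((quarter (c - j) : QuaternionGroup q) • v) ↔
      Γ.Adj ((quarter i : QuaternionGroup q) • v) ((quarter j : QuaternionGroup q) • v) := by
  rw [H.adj_quarter_smul hq, Γ.adj_comm ((quarter i : QuaternionGroup q) • v),
    H.adj_quarter_smul hq, sub_sub_sub_cancel_left]

theorem adj_flipInv_smul (H : IsInvolutionRigid (q := q) Γ) (hq : q = 3 ∨ q = 5)
    (g h : QuaternionGroup q) (v : V) :
    Γ.Adj (flipInv g • v) (flipInv h • v) ↔ Γ.Adj (g • v) (h • v) := by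
  rw [H.adj_smul_left, H.adj_smul_left, ← mul_smul, ← mul_smul]
  rcases inv_flipInv_mul_flipInv hq g h with e | e
  · rw [e]
  · rw [e, ← H.adj_smul_left, Γ.adj_comm]

theorem adj_flipInv_smul_of_fixed (hq : q = 3 ∨ q = 5) (H : IsInvolutionRigid (q := q) Γ) {u v : V}
    (hu : (a q : QuaternionGroup q) • u = u) (g : QuaternionGroup q) :
    Γ.Adj u (flipInv g • v) ↔ Γ.Adj u (g • v) := by
  rcases flipInv_eq hq g with e | e
  · rw [e]
  · rw [e, mul_a_self hq, mul_smul, H.adj_smul_right_of_fixed hu]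

theorem eq_or_eq_of_card_lt (H : IsInvolutionRigid (q := q) Γ) (hq : q = 3 ∨ q = 5) [Fintype V]
    (hV : Fintype.card V < 3 * q + 8) (v : V) :
    (a q : QuaternionGroup q) • v = v ∨ (a 2 : QuaternionGroup q) • v = v := by
  have : NeZero q := ⟨by rintro rfl; simp at hq⟩
  by_contra! hv
  have inj := smul_left_injective_of_moved hq hv.1 hv.2
  by_cases hfix : ∀ u ∉ Set.range fun g : QuaternionGroup q => g • v,
      (a q : QuaternionGroup q) • u = u
  · have := (H.smul_eq_of_involution inj (flipInv_flipInv hq) (fun g h => H.adj_flipInv_smul hq g h v)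
      (fun g u hu => H.adj_flipInv_smul_of_fixed hq (hfix u hu) g) (exists_flipInv_ne hq)).1 1
    exact hv.1 (by simpa using this.symm.trans (by rfl : _ = (1 : QuaternionGroup q) • v))
  push Not at hfix
  obtain ⟨w, hw, hzw⟩ := hfix
  have hdisj : ∀ g h : QuaternionGroup q, g • v ≠ h • w := fun g h e =>
    hw ⟨h⁻¹ * g, by simp only [mul_smul, e, inv_smul_smul]⟩
  have hrw : (a 2 : QuaternionGroup q) • w = w := by
    by_contra hrw
    have := Fintype.card_le_of_injective _
      (inj.sumElim (smul_left_injective_of_moved hq hzw hrw) hdisj)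
    rw [Fintype.card_sum, QuaternionGroup.card] at this
    omega
  obtain ⟨c, hc⟩ := ZMod.exists_reflection_four fun j => by
    classical exact decide (Γ.Adj v ((quarter j : QuaternionGroup q) • w))
  simp only [decide_eq_decide] at hc
  have hinj := inj.sumElim (quarter_smul_injective hq hzw) fun g j => hdisj g (quarter j)
  have hcard := Fintype.card_le_of_injective _ hinj
  have hsurj := ((Fintype.bijective_iff_injective_and_card _).2 ⟨hinj, by
    rw [Fintype.card_sum, QuaternionGroup.card, ZMod.card] at *
    omega⟩).2
  have hmixed : ∀ g j, Γ.Adj (g • v) ((quarter j : QuaternionGroup q) • w) ↔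
      Γ.Adj v ((quarter (j - toQuarter g) : QuaternionGroup q) • w) := fun g j => by
    obtain ⟨i, hi⟩ := exists_inv_mul_quarter hq g j
    rw [H.adj_smul_left, ← mul_smul, hi, mul_smul, eq_of_forall_rot_smul hrw]
  have hmixed' : ∀ g j, Γ.Adj (flipInv g • v) ((quarter (c - j) : QuaternionGroup q) • w) ↔
      Γ.Adj (g • v) ((quarter j : QuaternionGroup q) • w) := fun g j => by
    rw [hmixed, hmixed, toQuarter_flipInv hq, ← hc (j - toQuarter g)]
    congr! 3
    ring
  have := (H.smul_eq_of_involution hinj (τ := Sum.map flipInv (c - ·)) ?_ ?_ ?_ ?_).1 (Sum.inl 1)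
  · exact hv.1 (by simpa using this.symm.trans (by rfl : _ = (1 : QuaternionGroup q) • v))
  · rintro (g | j)
    · exact congrArg Sum.inl (flipInv_flipInv hq g)
    · exact congrArg Sum.inr (sub_sub_cancel c j)
  · rintro (g | i) (h | j)
    · exact H.adj_flipInv_smul hq g h v
    · exact hmixed' g j
    · exact (Γ.adj_comm _ _).trans ((hmixed' h i).trans (Γ.adj_comm _ _))
    · exact H.adj_quarter_reflect hq c i j w
  · exact fun x u hu => (hu (hsurj u)).elim
  · obtain ⟨g, hg⟩ := exists_flipInv_ne hq
    exact ⟨Sum.inl g, fun h => hg (Sum.inl_injective h)⟩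

/-- Points moved by the central involution do not form a single orbit of size four. -/
theorem exists_not_mem_quarter_orbit (H : IsInvolutionRigid (q := q) Γ) (hq : q = 3 ∨ q = 5)
    {w : V} (hw : (a q : QuaternionGroup q) • w ≠ w) :
    ∃ v, (a q : QuaternionGroup q) • v ≠ v ∧
      ∀ j : ZMod 4, v ≠ (quarter j : QuaternionGroup q) • w := by
  by_contra! hall
  have inj := quarter_smul_injective hq hw
  have hinj : Function.Injective fun b : Bool =>
      (quarter (if b then 2 else 0) : QuaternionGroup q) • w := fun b c h => by
    have := inj h
    clear * - this
    revert b c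
    decide
  have hz : (quarter 2 : QuaternionGroup q) = a q := by
    rcases hq with rfl | rfl <;> decide +kernel
  have hout : ∀ u ∉ Set.range fun b : Bool =>
      (quarter (if b then 2 else 0) : QuaternionGroup q) • w, ∀ b : Bool,
      Γ.Adj u ((quarter (if !b then 2 else 0) : QuaternionGroup q) • w) ↔
        Γ.Adj u ((quarter (if b then 2 else 0) : QuaternionGroup q) • w) := by
    intro u hu b
    by_cases hzu : (a q : QuaternionGroup q) • u = u
    · rw [← H.adj_smul_right_of_fixed hzu, ← hz, ← mul_smul, ← quarter_add hq]
      cases b <;> rfl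
    · obtain ⟨j, rfl⟩ := hall u hzu
      have hj : j = 1 ∨ j = 3 := by
        have h₀ : j ≠ 0 := fun h => hu ⟨false, by rw [h]; rfl⟩
        have h₂ : j ≠ 2 := fun h => hu ⟨true, by rw [h]; rfl⟩
        clear * - h₀ h₂
        revert j
        decide
      rw [← H.adj_quarter_reflect hq (2 * j), Γ.adj_comm]
      rw [Γ.adj_comm]
      rcases hj with rfl | rfl <;> cases b <;> rfl
  refine inj.ne (by decide : (3 : ZMod 4) ≠ 1) ?_
  have := (H.smul_eq_of_involution hinj Bool.not_not (fun b c => ?_) (fun b u hu => hout u hu b)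
    ⟨true, by decide⟩).2 ((quarter 1 : QuaternionGroup q) • w) ?_
  · rwa [← hz, ← mul_smul, ← quarter_add hq] at this
  · have := H.adj_quarter_reflect hq 2 (if b then 2 else 0) (if c then 2 else 0) w
    rw [← this]
    cases b <;> cases c <;> rfl
  · rintro ⟨b, hb⟩
    have := inj hb
    revert this
    cases b <;> decide

/-- A family of `rot`-orbits admitting compatible reflections cannot cover all points moved
by `rot`. -/
theorem exists_not_mem_rot_orbits (H : IsInvolutionRigid (q := q) Γ) (hq : q = 3 ∨ q = 5)
    {J : Type*} [Nonempty J] {x : J → V}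
    (hr : ∀ j, (a 2 : QuaternionGroup q) • x j ≠ x j)
    (hx : ∀ j k, j ≠ k → ∀ i : ZMod q, x j ≠ rot i • x k)
    (hz : ∃ w : V, (a q : QuaternionGroup q) • w ≠ w ∧ (a 2 : QuaternionGroup q) • w = w)
    (c : J → ZMod q)
    (hc : ∀ j k i, Γ.Adj (x j) (rot (c k - c j - i) • x k) ↔ Γ.Adj (x j) (rot i • x k)) :
    ∃ v, (a 2 : QuaternionGroup q) • v ≠ v ∧ ∀ j (i : ZMod q), v ≠ rot i • x j := by
  by_contra! hall
  obtain ⟨w, hzw, hrw⟩ := hz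
  refine hzw ((H.smul_eq_of_involution (injective_rot_family hq hr hx)
    (τ := fun p => (p.1, c p.1 - p.2)) (fun p => ?_) (fun p s => ?_) (fun p u hu => ?_) ?_).2 w ?_)
  · simp
  · simp only [H.adj_rot_smul hq]
    rw [← hc]
    congr! 3
    ring
  · have hru : (a 2 : QuaternionGroup q) • u = u := by
      by_contra hru
      obtain ⟨j, i, h⟩ := hall u hru
      exact hu ⟨(j, i), h.symm⟩
    rw [H.adj_smul_right_of_fixed (eq_of_forall_rot_smul hru _),
      H.adj_smul_right_of_fixed (eq_of_forall_rot_smul hru _)]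
  · obtain ⟨j⟩ := ‹Nonempty J›
    have : ∀ c : ZMod q, ∃ i, c - i ≠ i := by rcases hq with rfl | rfl <;> decide
    obtain ⟨i, hi⟩ := this (c j)
    exact ⟨(j, i), fun h => hi (congrArg Prod.snd h)⟩
  · rintro ⟨⟨j, i⟩, rfl⟩
    exact a_two_smul_rot_smul_ne hq (hr j) i hrw

theorem adj_rot_smul_neg (H : IsInvolutionRigid (q := q) Γ) (hq : q = 3 ∨ q = 5) (i : ZMod q)
    (u v : V) : Γ.Adj u (rot (-i) • v) ↔ Γ.Adj v (rot i • u) := by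
  rw [Γ.adj_comm v, H.adj_smul_left]
  congr! 2
  rw [eq_inv_iff_mul_eq_one, ← rot_add hq, neg_add_cancel]
  rcases hq with rfl | rfl <;> rfl

/-- The points moved by `rot` form at least three `rot`-orbits. -/
theorem exists_three_rot_orbits (H : IsInvolutionRigid (q := q) Γ) (hq : q = 3 ∨ q = 5)
    (hz : ∃ w : V, (a q : QuaternionGroup q) • w ≠ w ∧ (a 2 : QuaternionGroup q) • w = w)
    (hr : ∃ v : V, (a 2 : QuaternionGroup q) • v ≠ v) :
    ∃ x : Fin 3 → V, (∀ j, (a 2 : QuaternionGroup q) • x j ≠ x j) ∧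
      ∀ j k, j ≠ k → ∀ i : ZMod q, x j ≠ rot i • x k := by
  have hsymm : ∀ {u v : V}, (∀ i : ZMod q, u ≠ rot i • v) → ∀ i : ZMod q, v ≠ rot i • u := by
    intro u v h i e
    refine h (-i) ?_
    rw [e, ← mul_smul, ← rot_add hq, neg_add_cancel]
    rcases hq with rfl | rfl <;> exact (one_smul _ _).symm
  obtain ⟨x₀, h₀⟩ := hr
  obtain ⟨x₁, h₁, h₁₀⟩ := H.exists_not_mem_rot_orbits hq (J := Unit) (x := fun _ => x₀)
    (fun _ => h₀) (fun j k h => (h rfl).elim) hz (fun _ => 0) fun j k i => by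
      rw [sub_self, zero_sub, H.adj_rot_smul_neg hq]
  replace h₁₀ := h₁₀ ()
  obtain ⟨c, hc⟩ := ZMod.exists_reflection hq fun i => by
    classical exact decide (Γ.Adj x₀ (rot i • x₁))
  simp only [decide_eq_decide] at hc
  obtain ⟨x₂, h₂, h₂'⟩ := H.exists_not_mem_rot_orbits hq (J := Bool)
    (x := fun b => if b then x₁ else x₀) (by simp [h₀, h₁])
    (by simpa [h₁₀] using hsymm h₁₀) hz (fun b => if b then c else 0) (by
      have hneg := H.adj_rot_smul_neg hq
      have h : ∀ i, Γ.Adj x₁ (rot (-c - i) • x₀) ↔ Γ.Adj x₁ (rot i • x₀) := fun i => by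
        rw [← neg_neg i, ← neg_add', hneg, hneg, ← hc (-i)]
        congr! 3
        exact (sub_eq_add_neg _ _).symm
      simp [hc, hneg, h])
  refine ⟨![x₀, x₁, x₂], ?_, ?_⟩
  · simp [Fin.forall_fin_succ, h₀, h₁, h₂]
  · have h₂₀ := h₂' false
    have h₂₁ := h₂' true
    simp only [Bool.false_eq_true, if_false, if_true] at h₂₀ h₂₁
    have h₀₁ := hsymm h₁₀
    have h₀₂ := hsymm h₂₀
    have h₁₂ := hsymm h₂₁
    intro j k hjk
    fin_cases j <;> fin_cases k <;> first | exact (hjk rfl).elim | assumption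

theorem le_card (H : IsInvolutionRigid (q := q) Γ) (hq : q = 3 ∨ q = 5) [Fintype V]
    (hz : ∃ w : V, (a q : QuaternionGroup q) • w ≠ w)
    (hr : ∃ v : V, (a 2 : QuaternionGroup q) • v ≠ v) : 3 * q + 8 ≤ Fintype.card V := by
  by_contra! hV
  have hor := H.eq_or_eq_of_card_lt hq hV
  have : NeZero q := ⟨by rintro rfl; simp at hq⟩
  obtain ⟨w₀, hw₀⟩ := hz
  obtain ⟨w₁, hw₁, hne⟩ := H.exists_not_mem_quarter_orbit hq hw₀
  obtain ⟨x, hx, hxx⟩ :=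
    H.exists_three_rot_orbits hq ⟨w₀, hw₀, (hor w₀).resolve_left hw₀⟩ hr
  have hy := injective_quarter_family hq (J := Bool) (x := fun b => if b then w₁ else w₀)
    (by simp [hw₀, hw₁]) (by
      have h : ∀ i, w₀ ≠ (quarter i : QuaternionGroup q) • w₁ := fun i e => by
        refine hne (-i) ?_
        rw [← zero_sub, ← quarter_smul_eq_iff hq, ← e]
        rcases hq with rfl | rfl <;> exact (one_smul _ _).symm
      simpa [hne] using h)
  have hdisj : ∀ (p : Fin 3 × ZMod q) (s : Bool × ZMod 4),
      rot p.2 • x p.1 ≠ (quarter s.2 : QuaternionGroup q) • (if s.1 then w₁ else w₀) := by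
    rintro ⟨k, i⟩ ⟨b, j⟩ h
    rcases hor (rot i • x k) with h' | h'
    · refine a_smul_smul_ne hq (v := if b then w₁ else w₀) (g := quarter j) ?_ (h ▸ h')
      cases b <;> assumption
    · exact a_two_smul_rot_smul_ne hq (hx k) i h'
  have := Fintype.card_le_of_injective _ ((injective_rot_family hq hx hxx).sumElim hy hdisj)
  simp only [Fintype.card_sum, Fintype.card_prod, ZMod.card, Fintype.card_fin,
    Fintype.card_bool] at this
  omega

end IsInvolutionRigid

end Action

theorem le_of_aut_mulEquiv {q n : ℕ} (hq : q = 3 ∨ q = 5) (Γ : SimpleGraph (Fin n))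
    (e : (Γ ≃g Γ) ≃* QuaternionGroup q) : 3 * q + 8 ≤ n := by
  let _ : MulAction (QuaternionGroup q) (Fin n) :=
    { smul g v := e.symm g v
      one_smul v := by change e.symm 1 v = v; rw [map_one]; rfl
      mul_smul g h v := by change e.symm (g * h) v = _; rw [map_mul]; rfl }
  have H : IsInvolutionRigid (q := q) Γ :=
    { adj_smul g u v := (e.symm g).map_adj_iff
      eq_of_involution σ hσ := by
        rw [or_iff_not_imp_left]
        intro hne v
        have := eq_a_of_mul_self hq (e σ) (by rw [← map_mul, hσ, map_one])
          ((map_ne_one_iff e e.injective).2 hne)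
        change σ v = e.symm (a q) v
        rw [← this, e.symm_apply_apply] }
  have moved : ∀ g : QuaternionGroup q, g ≠ 1 → ∃ v : Fin n, g • v ≠ v := fun g hg => by
    by_contra! h
    exact hg ((map_eq_one_iff e.symm e.symm.injective).1 (RelIso.ext h))
  simpa using H.le_card hq (moved _ (a_self_ne_one hq)) (moved _ (a_two_ne_one hq))

/-- The relation generating `dicyclicGraph q`: a cycle on the first `3 * q` vertices, a cycle on
the last `8` vertices with its even vertices joined to the next even ones, and edges between the
two cycles that depend only on residues. -/
def dicyclicRel (q u v : ℕ) : Prop :=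
  (u < 3 * q ∧ v < 3 * q ∧ v = (u + 1) % (3 * q)) ∨
  (u < 3 * q ∧ 3 * q ≤ v ∧ u % 3 = 1 + ((v - 3 * q) / 2) % 2) ∨
  (3 * q ≤ u ∧ 3 * q ≤ v ∧ (v - 3 * q = (u - 3 * q + 1) % 8 ∨
    ((u - 3 * q) % 2 = 0 ∧ v - 3 * q = (u - 3 * q + 2) % 8)))

instance (q u v : ℕ) : Decidable (dicyclicRel q u v) := by
  unfold dicyclicRel; infer_instance

/-- A graph on `3 * q + 8` vertices on which the dicyclic group of order `4 * q` acts. -/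
def dicyclicGraph (q : ℕ) : SimpleGraph (Fin (3 * q + 8)) where
  Adj u v := u ≠ v ∧ (dicyclicRel q u v ∨ dicyclicRel q v u)
  symm := ⟨fun _ _ h => ⟨h.1.symm, h.2.symm⟩⟩
  loopless := ⟨fun _ h => h.1 rfl⟩

instance (q : ℕ) : DecidableRel (dicyclicGraph q).Adj := fun u v => by
  unfold dicyclicGraph; infer_instance

/-- The action of the dicyclic group on `ℕ` that restricts to the vertices of `dicyclicGraph q`. -/
def dicyclicMove (q : ℕ) : QuaternionGroup q → ℕ → ℕ
  | a i, v => if v < 3 * q then (v + 3 * i.val) % (3 * q)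
      else 3 * q + (v - 3 * q + 4 * i.val) % 8
  | xa i, v => if v < 3 * q then (3 * q - (v + 3 * i.val) % (3 * q)) % (3 * q)
      else 3 * q + (v - 3 * q + 2 + 4 * i.val) % 8

/-- The action of the dicyclic group on the vertices of `dicyclicGraph q`. -/
def dicyclicAct (q : ℕ) (g : QuaternionGroup q) (v : Fin (3 * q + 8)) : Fin (3 * q + 8) :=
  Fin.ofNat _ (dicyclicMove q g v)

/-- An order in which the vertices of `dicyclicGraph q` become distinguishable from the earlier
ones once the vertices `0` and `3 * q` are fixed. -/
def dicyclicRank (q v : ℕ) : ℕ :=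
  if v = 3 * q then 0 else if v < 3 * q then v
  else 3 * q + (if v = 3 * q + 4 then 1 else if v % 2 = q % 2 then 3 else 2)

theorem dicyclicAct_mul {q : ℕ} (hq : q = 3 ∨ q = 5) : ∀ (g h : QuaternionGroup q) v,
    dicyclicAct q (g * h) v = dicyclicAct q g (dicyclicAct q h v) := by
  rcases hq with rfl | rfl <;> decide +kernel

theorem dicyclicAct_one {q : ℕ} (hq : q = 3 ∨ q = 5) : ∀ v, dicyclicAct q 1 v = v := by
  rcases hq with rfl | rfl <;> decide +kernel

theorem eq_one_of_dicyclicAct {q : ℕ} (hq : q = 3 ∨ q = 5) : ∀ g : QuaternionGroup q,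
    (∀ v, dicyclicAct q g v = v) → g = 1 := by
  rcases hq with rfl | rfl <;> decide +kernel

theorem dicyclicGraph_adj_act {q : ℕ} (hq : q = 3 ∨ q = 5) : ∀ (g : QuaternionGroup q) u v,
    (dicyclicGraph q).Adj (dicyclicAct q g u) (dicyclicAct q g v) ↔
      (dicyclicGraph q).Adj u v := by
  rcases hq with rfl | rfl <;> decide +kernel

theorem exists_dicyclicAct_eq {q : ℕ} (hq : q = 3 ∨ q = 5) : ∀ u v,
    (dicyclicGraph q).degree u = (dicyclicGraph q).degree (Fin.ofNat _ 0) →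
    (dicyclicGraph q).degree v = (dicyclicGraph q).degree (Fin.ofNat _ (3 * q)) →
    ∃ g, dicyclicAct q g (Fin.ofNat _ 0) = u ∧ dicyclicAct q g (Fin.ofNat _ (3 * q)) = v := by
  rcases hq with rfl | rfl <;> decide +kernel

theorem dicyclicGraph_eq_of_rank {q : ℕ} (hq : q = 3 ∨ q = 5) : ∀ v w : Fin (3 * q + 8),
    dicyclicRank q v ≠ 0 → (dicyclicGraph q).degree w = (dicyclicGraph q).degree v →
    (∀ u : Fin (3 * q + 8), dicyclicRank q u < dicyclicRank q v →
      w ≠ u ∧ ((dicyclicGraph q).Adj w u ↔ (dicyclicGraph q).Adj v u)) → w = v := by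
  rcases hq with rfl | rfl <;> decide +kernel

theorem eq_of_dicyclicRank_eq_zero {q : ℕ} (hq : q = 3 ∨ q = 5) : ∀ v : Fin (3 * q + 8),
    dicyclicRank q v = 0 → v = Fin.ofNat _ 0 ∨ v = Fin.ofNat _ (3 * q) := by
  rcases hq with rfl | rfl <;> decide +kernel

theorem dicyclicGraph_aut_eq_one {q : ℕ} (hq : q = 3 ∨ q = 5)
    (f : dicyclicGraph q ≃g dicyclicGraph q) (h₀ : f (Fin.ofNat _ 0) = Fin.ofNat _ 0)
    (h₁ : f (Fin.ofNat _ (3 * q)) = Fin.ofNat _ (3 * q)) (v : Fin (3 * q + 8)) : f v = v := by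
  induction hn : dicyclicRank q v using Nat.strong_induction_on generalizing v with
  | _ n ih =>
    subst hn
    by_cases hv : dicyclicRank q v = 0
    · rcases eq_of_dicyclicRank_eq_zero hq v hv with rfl | rfl
      exacts [h₀, h₁]
    · refine dicyclicGraph_eq_of_rank hq v (f v) hv (f.degree_eq v) fun u hu => ?_
      have hfu : f u = u := ih _ hu u rfl
      refine ⟨fun h => ?_, ?_⟩
      · rw [← hfu] at h
        rw [f.injective h] at hu
        exact hu.false
      · rw [← f.map_adj_iff (v := v), hfu]

/-- The action of the dicyclic group on `dicyclicGraph q` by automorphisms. -/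
def dicyclicHom {q : ℕ} (hq : q = 3 ∨ q = 5) :
    QuaternionGroup q →* (dicyclicGraph q ≃g dicyclicGraph q) where
  toFun g :=
    { toFun := dicyclicAct q g
      invFun := dicyclicAct q g⁻¹
      left_inv := fun v => by
        rw [← dicyclicAct_mul hq, inv_mul_cancel, dicyclicAct_one hq]
      right_inv := fun v => by
        rw [← dicyclicAct_mul hq, mul_inv_cancel, dicyclicAct_one hq]
      map_rel_iff' := dicyclicGraph_adj_act hq g _ _ }
  map_one' := RelIso.ext (dicyclicAct_one hq)
  map_mul' g h := RelIso.ext (dicyclicAct_mul hq g h)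

theorem dicyclicHom_bijective {q : ℕ} (hq : q = 3 ∨ q = 5) :
    Function.Bijective (dicyclicHom hq) := by
  refine ⟨(injective_iff_map_eq_one _).2 fun g hg => eq_one_of_dicyclicAct hq g fun v =>
    DFunLike.congr_fun hg v, fun f => ?_⟩
  obtain ⟨g, h₀, h₁⟩ := exists_dicyclicAct_eq hq _ _ (f.degree_eq (Fin.ofNat _ 0))
    (f.degree_eq (Fin.ofNat _ (3 * q)))
  refine ⟨g, RelIso.ext fun v => ?_⟩
  have key := dicyclicGraph_aut_eq_one hq ((dicyclicHom hq g)⁻¹ * f)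
    (((dicyclicHom hq g).symm_apply_eq).2 h₀.symm) (((dicyclicHom hq g).symm_apply_eq).2 h₁.symm) v
  exact (((dicyclicHom hq g).symm_apply_eq).1 key).symm

end

/-- Proposition: for `q ∈ {3, 5}`, the dicyclic group `Dic_q` of order `4q`
satisfies `α(Dic_q) = 3q + 8`; that is, `α(Dic₃) = 17` and `α(Dic₅) = 23`. -/
theorem alpha_dicyclic_three_five (q : ℕ) (hq : q = 3 ∨ q = 5) :
    graphAlpha (QuaternionGroup q) = 3 * q + 8 := by
  have mem : 3 * q + 8 ∈
      {n : ℕ | ∃ Γ : SimpleGraph (Fin n), Nonempty ((Γ ≃g Γ) ≃* QuaternionGroup q)} :=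
    ⟨dicyclicGraph q, ⟨(MulEquiv.ofBijective _ (dicyclicHom_bijective hq)).symm⟩⟩
  refine le_antisymm (Nat.sInf_le mem) (le_csInf ⟨_, mem⟩ ?_)
  rintro n ⟨Γ, ⟨e⟩⟩
  exact le_of_aut_mulEquiv hq Γ e
end
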